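/- Let T > 0, ε ∈ (0, 1/4], Γ > 0, and x⁰ a point of the torus. Suppose ω̄, ρ : [0,T] × 𝕋² → ℝ and u : [0,T] × 𝕋² → ℝ² are C² functions such that at every time t the field u(t,·) is divergence-free, has zero mean, and satisfies ∂₁u₂ − ∂₂u₁ = ω̄ + ρ, and the transport equations ∂ₜω̄ + u·∇ω̄ = 0 and ∂ₜρ + u·∇ρ = 0 hold, with initial data ω̄(0,x) = ω̄⁰(x₂) depending only on x₂ (smooth) and ρ(0,x) = Γ p^ε(x − x⁰); assume moreover ρ(t,·) is supported in B(x⁰, 1/4) for all t ∈ [0,T] and define the barycenter G(t) = (G₁(t), G₂(t)) := Γ⁻¹ ∫_{𝕋²} x ρ(t,x) dx (using coordinates centered at x⁰ on the fundamental domain). If ∂₂ω̄⁰(x⁰) > 0, then G₂′(0) = 0 and there is a constant C depending only on ω̄⁰ and p (not on ε or the solution) such that |G₂″(0) − (Γ ∂₂ω̄⁰(x⁰)/(4π)) ln(1/ε)| ≤ C; consequently, if ε is small enough that (Γ ∂₂ω̄⁰(x⁰)/(4π)) ln(1/ε) > C, there exists T′ ∈ (0,T] such that G₂ is strictly increasing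 on [0,T′]. -/

import Mathlib

open MeasureTheory Real

noncomputable section

/-- The fundamental square `[−1/2,1/2]²` of the flat torus `𝕋²`. -/
def sq2 : Set (EuclideanSpace ℝ (Fin 2)) :=
  {x | ∀ i, x i ∈ Set.Icc (-(1/2) : ℝ) (1/2)}

/-- The lattice vector of `ℤ² ⊂ ℝ²` associated with `k`. -/
def zvec2 (k : Fin 2 → ℤ) : EuclideanSpace ℝ (Fin 2) :=
  (WithLp.equiv 2 (Fin 2 → ℝ)).symm fun i => (k i : ℝ)

/-- The `i`-th standard basis vector of `ℝ²`. -/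
def e2 (i : Fin 2) : EuclideanSpace ℝ (Fin 2) := EuclideanSpace.single i (1 : ℝ)


/-- Partial derivative in the first variable. -/
def pd1 (f : ℝ × ℝ → ℝ) (z : ℝ × ℝ) : ℝ := fderiv ℝ f z (1, 0)

/-- Partial derivative in the second variable. -/
def pd2 (f : ℝ × ℝ → ℝ) (z : ℝ × ℝ) : ℝ := fderiv ℝ f z (0, 1)

/-- The unit interval centered at zero. -/
def iq : Set ℝ := Set.Icc (-(1/2) : ℝ) (1/2)

/-- The unit square centered at zero. -/
def qq : Set (ℝ × ℝ) := iq ×ˢ iq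

lemma iq_compact : IsCompact iq := isCompact_Icc

lemma qq_compact : IsCompact qq := iq_compact.prod iq_compact

lemma qq_meas : MeasurableSet qq := qq_compact.measurableSet

lemma intOn_qq {f : ℝ × ℝ → ℝ} (hf : Continuous f) : IntegrableOn f qq :=
  hf.continuousOn.integrableOn_compact qq_compact

lemma vol_iq : volume.real iq = 1 := by
  simp [iq, Measure.real]; norm_num

lemma vol_qq : volume.real qq = 1 := by
  rw [qq, Measure.volume_eq_prod, measureReal_prod_prod, vol_iq, one_mul]

lemma int_iq (f : ℝ → ℝ) : ∫ x in iq, f x = ∫ x in (-(1/2) : ℝ)..(1/2), f x := by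
  rw [intervalIntegral.integral_of_le (by norm_num), iq, integral_Icc_eq_integral_Ioc]

lemma int_qq {f : ℝ × ℝ → ℝ} (hf : IntegrableOn f qq) :
    ∫ z in qq, f z = ∫ x in iq, ∫ y in iq, f (x, y) := by
  rw [qq, Measure.volume_eq_prod, setIntegral_prod]
  exact hf

lemma int_qq' {f : ℝ × ℝ → ℝ} (hf : IntegrableOn f qq) :
    ∫ z in qq, f z = ∫ y in iq, ∫ x in iq, f (x, y) := by
  rw [int_qq hf, integral_integral_swap]
  have : IntegrableOn f (iq ×ˢ iq) (volume.prod volume) := hf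
  rw [IntegrableOn, ← Measure.prod_restrict] at this
  exact this

lemma pd1_cont {f : ℝ × ℝ → ℝ} (hf : ContDiff ℝ 1 f) : Continuous (pd1 f) :=
  (hf.continuous_fderiv one_ne_zero).clm_apply continuous_const

lemma pd2_cont {f : ℝ × ℝ → ℝ} (hf : ContDiff ℝ 1 f) : Continuous (pd2 f) :=
  (hf.continuous_fderiv one_ne_zero).clm_apply continuous_const

lemma pd1_cd {f : ℝ × ℝ → ℝ} (hf : ContDiff ℝ 2 f) : ContDiff ℝ 1 (pd1 f) :=
  (hf.fderiv_right (m := 1) (by norm_num)).clm_apply contDiff_const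

lemma pd2_cd {f : ℝ × ℝ → ℝ} (hf : ContDiff ℝ 2 f) : ContDiff ℝ 1 (pd2 f) :=
  (hf.fderiv_right (m := 1) (by norm_num)).clm_apply contDiff_const

lemma pd1_has {f : ℝ × ℝ → ℝ} (hf : Differentiable ℝ f) (x y : ℝ) :
    HasDerivAt (fun s => f (s, y)) (pd1 f (x, y)) x := by
  have h : HasDerivAt (fun s : ℝ => ((s, y) : ℝ × ℝ)) (1, 0) x :=
    (hasDerivAt_id x).prodMk (hasDerivAt_const x y)
  exact (hf (x, y)).hasFDerivAt.comp_hasDerivAt x h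

lemma pd2_has {f : ℝ × ℝ → ℝ} (hf : Differentiable ℝ f) (x y : ℝ) :
    HasDerivAt (fun s => f (x, s)) (pd2 f (x, y)) y := by
  have h : HasDerivAt (fun s : ℝ => ((x, s) : ℝ × ℝ)) (0, 1) y :=
    (hasDerivAt_const y x).prodMk (hasDerivAt_id y)
  exact (hf (x, y)).hasFDerivAt.comp_hasDerivAt y h

/-- Divergence theorem on rectangles. -/
lemma div_rect {f g : ℝ × ℝ → ℝ} (hf : ContDiff ℝ 1 f) (hg : ContDiff ℝ 1 g) (a b c d : ℝ) :
    (∫ x in a..b, ∫ y in c..d, pd1 f (x, y) + pd2 g (x, y)) =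
      (((∫ x in a..b, g (x, d)) - ∫ x in a..b, g (x, c)) + ∫ y in c..d, f (b, y)) -
        ∫ y in c..d, f (a, y) := by
  apply integral2_divergence_prod_of_hasFDerivAt f g (fderiv ℝ f) (fderiv ℝ g) a c b d
    hf.continuous.continuousOn hg.continuous.continuousOn
  · intro x _; exact (hf.differentiable one_ne_zero x).hasFDerivAt
  · intro x _; exact (hg.differentiable one_ne_zero x).hasFDerivAt
  · exact ((pd1_cont hf).add (pd2_cont hg)).continuousOn.integrableOn_compact
      (isCompact_uIcc.prod isCompact_uIcc)

/-- Divergence theorem on the square, periodic boundary conditions. -/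
lemma div_qq {f g : ℝ × ℝ → ℝ} (hf : ContDiff ℝ 1 f) (hg : ContDiff ℝ 1 g)
    (h1 : ∀ y ∈ iq, f (1/2, y) = f (-(1/2), y)) (h2 : ∀ x ∈ iq, g (x, 1/2) = g (x, -(1/2))) :
    ∫ z in qq, (pd1 f z + pd2 g z) = 0 := by
  rw [int_qq (f := fun z => pd1 f z + pd2 g z)
    (intOn_qq ((pd1_cont hf).add (pd2_cont hg))), int_iq]
  simp_rw [int_iq]
  rw [div_rect hf hg]
  simp_rw [← int_iq]
  rw [setIntegral_congr_fun iq_compact.measurableSet h1,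
    setIntegral_congr_fun iq_compact.measurableSet h2]
  ring

lemma pd1_mul {f g : ℝ × ℝ → ℝ} {z : ℝ × ℝ} (hf : DifferentiableAt ℝ f z)
    (hg : DifferentiableAt ℝ g z) :
    pd1 (fun z => f z * g z) z = pd1 f z * g z + f z * pd1 g z := by
  simp only [pd1]; rw [fderiv_fun_mul hf hg]; simp; ring

lemma pd2_mul {f g : ℝ × ℝ → ℝ} {z : ℝ × ℝ} (hf : DifferentiableAt ℝ f z)
    (hg : DifferentiableAt ℝ g z) :
    pd2 (fun z => f z * g z) z = pd2 f z * g z + f z * pd2 g z := by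
  simp only [pd2]; rw [fderiv_fun_mul hf hg]; simp; ring

lemma pd1_sub {f g : ℝ × ℝ → ℝ} {z : ℝ × ℝ} (hf : DifferentiableAt ℝ f z)
    (hg : DifferentiableAt ℝ g z) :
    pd1 (fun z => f z - g z) z = pd1 f z - pd1 g z := by
  simp only [pd1]; rw [fderiv_fun_sub hf hg]; simp

lemma pd2_sub {f g : ℝ × ℝ → ℝ} {z : ℝ × ℝ} (hf : DifferentiableAt ℝ f z)
    (hg : DifferentiableAt ℝ g z) :
    pd2 (fun z => f z - g z) z = pd2 f z - pd2 g z := by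
  simp only [pd2]; rw [fderiv_fun_sub hf hg]; simp

lemma pd_swap {f : ℝ × ℝ → ℝ} (hf : ContDiff ℝ 2 f) (z : ℝ × ℝ) :
    pd1 (pd2 f) z = pd2 (pd1 f) z := by
  have hd : DifferentiableAt ℝ (fderiv ℝ f) z :=
    (hf.fderiv_right (m := 1) (by norm_num)).differentiable one_ne_zero z
  have h := (hf.contDiffAt (x := z)).isSymmSndFDerivAt (by simp)
  have e : ∀ v w : ℝ × ℝ, fderiv ℝ (fun y => fderiv ℝ f y v) z w = fderiv ℝ (fderiv ℝ f) z w v := by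
    intro v w
    rw [fderiv_clm_apply hd (differentiableAt_const _)]; simp
  change fderiv ℝ (fun y => fderiv ℝ f y (0, 1)) z (1, 0)
    = fderiv ℝ (fun y => fderiv ℝ f y (1, 0)) z (0, 1)
  rw [e, e]
  exact h.eq _ _

/-- The div-curl identity on the square. -/
lemma div_curl {a b : ℝ × ℝ → ℝ} (ha : ContDiff ℝ 2 a) (hb : ContDiff ℝ 2 b)
    (ha1 : ∀ y, a (1/2, y) = a (-(1/2), y)) (ha2 : ∀ x, a (x, 1/2) = a (x, -(1/2)))
    (hb1 : ∀ y, b (1/2, y) = b (-(1/2), y)) (hb2 : ∀ x, b (x, 1/2) = b (x, -(1/2))) :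
    ∫ z in qq, ((pd1 b z) ^ 2) ≤
      ∫ z in qq, ((pd1 a z + pd2 b z) ^ 2 + (pd1 b z - pd2 a z) ^ 2) := by
  have ha' := ha.of_le (m := 1) (by norm_num)
  have hb' := hb.of_le (m := 1) (by norm_num)
  have hda := ha.differentiable two_ne_zero
  have hdb := hb.differentiable two_ne_zero
  have c1 := pd1_cont ha'
  have c2 := pd2_cont ha'
  have c3 := pd1_cont hb'
  have c4 := pd2_cont hb'
  have key := div_qq (f := fun z => a z * pd2 b z) (g := fun z => (-a z) * pd1 b z)
    (ha'.mul (pd2_cd hb)) (ha'.neg.mul (pd1_cd hb)) (fun y _ => by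
      have : pd2 b (1/2, y) = pd2 b (-(1/2), y) := by
        rw [← (pd2_has hdb (1/2) y).deriv, ← (pd2_has hdb (-(1/2)) y).deriv]
        congr 1; ext s; exact hb1 s
      simp only [this, ha1]) (fun x _ => by
      have : pd1 b (x, 1/2) = pd1 b (x, -(1/2)) := by
        rw [← (pd1_has hdb x (1/2)).deriv, ← (pd1_has hdb x (-(1/2))).deriv]
        congr 1; ext s; exact hb2 s
      simp only [this, ha2])
  have e : ∀ z, pd1 (fun z => a z * pd2 b z) z + pd2 (fun z => (-a z) * pd1 b z) z
      = pd1 a z * pd2 b z - pd2 a z * pd1 b z := by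
    intro z
    rw [pd1_mul (hda z) ((pd2_cd hb).differentiable one_ne_zero z),
      pd2_mul (f := fun z => -a z) (hda z).neg ((pd1_cd hb).differentiable one_ne_zero z), pd_swap hb]
    have : pd2 (fun z => -a z) z = - pd2 a z := by simp [pd2, fderiv_fun_neg]
    rw [this]; ring
  simp_rw [e] at key
  have : ∫ z in qq, ((pd1 a z + pd2 b z) ^ 2 + (pd1 b z - pd2 a z) ^ 2)
      = ∫ z in qq, (((pd1 a z) ^ 2 + (pd2 a z) ^2 + (pd1 b z)^2 + (pd2 b z)^2)
        + 2 * (pd1 a z * pd2 b z - pd2 a z * pd1 b z)) := by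
    congr 1; ext z; ring
  rw [this, integral_add, integral_const_mul, key, mul_zero, add_zero]
  · apply setIntegral_mono (intOn_qq (by fun_prop)) (intOn_qq (by fun_prop))
    intro z; simp only; nlinarith [sq_nonneg (pd1 a z), sq_nonneg (pd2 a z), sq_nonneg (pd2 b z)]
  · exact intOn_qq (by fun_prop)
  · exact intOn_qq (by fun_prop)

/-- One-dimensional Poincare type estimate, pointwise. -/
lemma poinc {f f' : ℝ → ℝ} (hf : ∀ x, HasDerivAt f (f' x) x) (hc : Continuous f') {m : ℝ}
    (hm : |∫ x in iq, f x| ≤ m) {x : ℝ} (hx : x ∈ iq) :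
    (f x) ^ 2 ≤ 2 * m ^ 2 + 2 * ∫ s in iq, (f' s) ^ 2 := by
  have hfc : Continuous f := continuous_iff_continuousAt.2 fun x => (hf x).continuousAt
  have i1 : ∀ {g : ℝ → ℝ}, Continuous g → IntegrableOn g iq := fun h =>
    h.continuousOn.integrableOn_compact iq_compact
  set A := ∫ s in iq, |f' s|
  have h1 : ∀ x' ∈ iq, |f x - f x'| ≤ A := by
    intro x' hx'
    rw [← intervalIntegral.integral_eq_sub_of_hasDerivAt (fun x _ => hf x)
      (hc.intervalIntegrable _ _)]
    rw [← Real.norm_eq_abs]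
    refine (intervalIntegral.norm_integral_le_integral_norm_uIoc).trans ?_
    apply setIntegral_mono_set (i1 hc.abs) (Filter.Eventually.of_forall fun _ => abs_nonneg _)
    apply Filter.Eventually.of_forall
    intro y hy
    exact Set.uIcc_subset_Icc hx' hx (Set.uIoc_subset_uIcc hy)
  have h2 : |f x - ∫ s in iq, f s| ≤ A := by
    have : f x - ∫ s in iq, f s = ∫ s in iq, (f x - f s) := by
      rw [integral_sub (i1 continuous_const) (i1 hfc)]; simp [vol_iq]
    rw [this, ← Real.norm_eq_abs]
    have := norm_setIntegral_le_of_norm_le_const (μ := volume) (s := iq) (f := fun s => f x - f s)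
      (C := A) iq_compact.measure_lt_top h1
    simpa [vol_iq] using this
  have h3 : A ^ 2 ≤ ∫ s in iq, (f' s) ^ 2 := by
    have : 0 ≤ ∫ s in iq, (|f' s| - A) ^ 2 := integral_nonneg fun _ => sq_nonneg _
    have e : ∫ s in iq, (|f' s| - A) ^ 2 = ∫ s in iq, ((f' s) ^ 2 - (2 * A) * |f' s| + A ^ 2) := by
      congr 1; ext s; rw [sub_sq, sq_abs]; ring
    rw [e, integral_add, integral_sub, integral_const_mul] at this
    · simp [vol_iq] at this
      change 0 ≤ _ - 2 * A * A + A ^ 2 at this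
      nlinarith
    · exact i1 (by fun_prop)
    · exact i1 (by fun_prop)
    · exact i1 (by fun_prop)
    · exact i1 (by fun_prop)
  have h4 : |f x| ≤ m + A := by
    have := abs_add_le (f x - ∫ s in iq, f s) (∫ s in iq, f s)
    rw [sub_add_cancel] at this
    linarith
  have : (f x) ^ 2 ≤ (m + A) ^ 2 := by rw [← sq_abs]; gcongr
  nlinarith [sq_nonneg (m - A)]


lemma polar_int (f : ℝ × ℝ → ℝ) :
    ∫ z, f z = ∫ q in Set.Ioi (0:ℝ) ×ˢ Set.Ioo (-π) π,
      q.1 * f (q.1 * cos q.2, q.1 * sin q.2) := by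
  rw [← integral_comp_polarCoord_symm]; rfl

lemma polar_on {F : ℝ × ℝ → ℝ} (hF : Continuous F) {R : ℝ}
    (h0 : ∀ q, R < q.1 → F q = 0) : IntegrableOn F (Set.Ioi (0:ℝ) ×ˢ Set.Ioo (-π) π) := by
  have h1 : IntegrableOn F (Set.Icc 0 R ×ˢ Set.Icc (-π) π) :=
    hF.continuousOn.integrableOn_compact (isCompact_Icc.prod isCompact_Icc)
  have h2 : IntegrableOn F (Set.Ioi R ×ˢ Set.Icc (-π) π) := by
    apply integrableOn_zero.congr_fun (f := fun _ => (0:ℝ)) _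
      (measurableSet_Ioi.prod measurableSet_Icc)
    intro q hq; exact (h0 q hq.1).symm
  apply (h1.union h2).mono_set
  rintro ⟨r, t⟩ ⟨hr, ht⟩
  rcases le_or_gt r R with h | h
  · exact Or.inl ⟨⟨le_of_lt hr, h⟩, ⟨ht.1.le, ht.2.le⟩⟩
  · exact Or.inr ⟨h, ⟨ht.1.le, ht.2.le⟩⟩

lemma csupp_bound {g : ℝ × ℝ → ℝ} (hs : HasCompactSupport g) :
    ∃ R : ℝ, 0 < R ∧ ∀ z, R < ‖z‖ → z ∉ tsupport g := by
  obtain ⟨R, hR, h⟩ := hs.isCompact.isBounded.exists_pos_norm_le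
  exact ⟨R, hR, fun z hz hm => absurd (h z hm) (not_le.2 hz)⟩

lemma norm_polar (r t : ℝ) (hr : 0 < r) : r / 2 ≤ ‖((r * cos t, r * sin t) : ℝ × ℝ)‖ := by
  rw [Prod.norm_def, le_max_iff]
  simp only [Real.norm_eq_abs, abs_mul, abs_of_pos hr]
  by_contra h
  push Not at h
  have h1 : |cos t| < 1/2 := by nlinarith
  have h2 : |sin t| < 1/2 := by nlinarith
  have := cos_sq_add_sin_sq t
  rw [← sq_abs (cos t), ← sq_abs (sin t)] at this
  nlinarith [abs_nonneg (cos t), abs_nonneg (sin t)]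

lemma fd_split (g : ℝ × ℝ → ℝ) (z : ℝ × ℝ) (a b : ℝ) :
    fderiv ℝ g z (a, b) = a * pd1 g z + b * pd2 g z := by
  have : ((a, b) : ℝ × ℝ) = a • (1, 0) + b • (0, 1) := by simp
  rw [this, map_add, map_smul, map_smul]; rfl

lemma pd_zero {g : ℝ × ℝ → ℝ} {z : ℝ × ℝ} (h : z ∉ tsupport g) : pd1 g z = 0 ∧ pd2 g z = 0 := by
  have : fderiv ℝ g z = 0 := by
    by_contra h'
    exact h (support_fderiv_subset ℝ h')
  simp [pd1, pd2, this]

/-- Radial part of the fundamental solution identity. -/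
lemma radial_id {g : ℝ × ℝ → ℝ} (hg : ContDiff ℝ 1 g) (hs : HasCompactSupport g) :
    ∫ z : ℝ × ℝ, (z.1 * pd1 g z + z.2 * pd2 g z) / (z.1 ^ 2 + z.2 ^ 2) = - (2 * π) * g 0 := by
  obtain ⟨R, hR, hz⟩ := csupp_bound hs
  have hc1 := pd1_cont hg
  have hc2 := pd2_cont hg
  set F : ℝ × ℝ → ℝ := fun q => cos q.2 * pd1 g (q.1 * cos q.2, q.1 * sin q.2)
    + sin q.2 * pd2 g (q.1 * cos q.2, q.1 * sin q.2) with hF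
  have hFc : Continuous F := by fun_prop
  have hon : IntegrableOn F (Set.Ioi (0:ℝ) ×ˢ Set.Ioo (-π) π) := by
    apply polar_on hFc (R := 2 * R)
    intro q hq
    have hq0 : 0 < q.1 := by linarith
    have := pd_zero (hz (q.1 * cos q.2, q.1 * sin q.2) (by linarith [norm_polar q.1 q.2 hq0]))
    simp [hF, this.1, this.2]
  rw [polar_int]
  have e : ∫ q in Set.Ioi (0:ℝ) ×ˢ Set.Ioo (-π) π, q.1 * ((q.1 * cos q.2 *
      pd1 g (q.1 * cos q.2, q.1 * sin q.2) + q.1 * sin q.2 * pd2 g (q.1 * cos q.2, q.1 * sin q.2))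
      / ((q.1 * cos q.2) ^ 2 + (q.1 * sin q.2) ^ 2))
      = ∫ q in Set.Ioi (0:ℝ) ×ˢ Set.Ioo (-π) π, F q := by
    apply setIntegral_congr_fun (measurableSet_Ioi.prod measurableSet_Ioo)
    intro q hq
    have hq0 : q.1 ≠ 0 := ne_of_gt hq.1
    have : (q.1 * cos q.2) ^ 2 + (q.1 * sin q.2) ^ 2 = q.1 ^ 2 := by
      rw [mul_pow, mul_pow, ← mul_add, cos_sq_add_sin_sq, mul_one]
    simp only [this, hF]
    field_simp
  refine e.trans ?_
  have hon' : Integrable F ((volume.restrict (Set.Ioi (0:ℝ))).prod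
      (volume.restrict (Set.Ioo (-π) π))) := by
    rw [Measure.prod_restrict]; exact hon
  rw [Measure.volume_eq_prod, ← Measure.prod_restrict, integral_prod_symm F hon']
  have inner : ∀ t : ℝ, ∫ r in Set.Ioi (0:ℝ), F (r, t) = - g 0 := by
    intro t
    have hd : ∀ r, HasDerivAt (fun r => g (r * cos t, r * sin t)) (F (r, t)) r := by
      intro r
      have h : HasDerivAt (fun r : ℝ => ((r * cos t, r * sin t) : ℝ × ℝ)) (cos t, sin t) r := by
        have h1 := (hasDerivAt_id r).mul_const (cos t)
        have h2 := (hasDerivAt_id r).mul_const (sin t)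
        simpa using h1.prodMk h2
      have := ((hg.differentiable one_ne_zero) (r * cos t, r * sin t)).hasFDerivAt.comp_hasDerivAt r h
      rw [fd_split] at this
      exact this
    have hz' : ∀ r, 2 * R < r → g (r * cos t, r * sin t) = 0 := fun r hr =>
      image_eq_zero_of_notMem_tsupport
        (hz _ (by linarith [norm_polar r t (by linarith)]))
    have hz2 : ∀ r, 2 * R < r → F (r, t) = 0 := fun r hr => by
      have := pd_zero (hz (r * cos t, r * sin t) (by linarith [norm_polar r t (by linarith)]))
      simp [hF, this.1, this.2]
    have hi : IntegrableOn (fun r => F (r, t)) (Set.Ioi 0) := by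
      have h1 : IntegrableOn (fun r => F (r, t)) (Set.Icc 0 (2 * R)) :=
        (by fun_prop : Continuous fun r => F (r, t)).continuousOn.integrableOn_compact isCompact_Icc
      have h2 : IntegrableOn (fun r => F (r, t)) (Set.Ioi (2 * R)) := by
        apply integrableOn_zero.congr_fun (f := fun _ => (0:ℝ)) _ measurableSet_Ioi
        intro q hq; exact (hz2 q hq).symm
      apply (h1.union h2).mono_set
      intro r hr
      rcases le_or_gt r (2 * R) with h | h
      · exact Or.inl ⟨le_of_lt hr, h⟩
      · exact Or.inr h
    have := integral_Ioi_of_hasDerivAt_of_tendsto (a := 0) (m := 0)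
      (hd 0).continuousAt.continuousWithinAt (fun r _ => hd r) hi
      (tendsto_const_nhds.congr' (by
        filter_upwards [Filter.eventually_gt_atTop (2 * R)] with r hr
        exact (hz' r hr).symm))
    rw [this]; simp; rfl
  simp only [inner]
  simp [pi_pos.le]
  left; ring

/-- Angular part of the fundamental solution identity. -/
lemma angular_id {g : ℝ × ℝ → ℝ} (hg : ContDiff ℝ 1 g) (hs : HasCompactSupport g) :
    ∫ z : ℝ × ℝ, (-z.2 * pd1 g z + z.1 * pd2 g z) / (z.1 ^ 2 + z.2 ^ 2) = 0 := by
  obtain ⟨R, hR, hz⟩ := csupp_bound hs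
  have hc1 := pd1_cont hg
  have hc2 := pd2_cont hg
  set F : ℝ × ℝ → ℝ := fun q => -sin q.2 * pd1 g (q.1 * cos q.2, q.1 * sin q.2)
    + cos q.2 * pd2 g (q.1 * cos q.2, q.1 * sin q.2) with hF
  have hFc : Continuous F := by fun_prop
  have hon : IntegrableOn F (Set.Ioi (0:ℝ) ×ˢ Set.Ioo (-π) π) := by
    apply polar_on hFc (R := 2 * R)
    intro q hq
    have hq0 : 0 < q.1 := by linarith
    have := pd_zero (hz (q.1 * cos q.2, q.1 * sin q.2) (by linarith [norm_polar q.1 q.2 hq0]))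
    simp [hF, this.1, this.2]
  rw [polar_int]
  have e : ∫ q in Set.Ioi (0:ℝ) ×ˢ Set.Ioo (-π) π, q.1 * ((-(q.1 * sin q.2) *
      pd1 g (q.1 * cos q.2, q.1 * sin q.2) + q.1 * cos q.2 * pd2 g (q.1 * cos q.2, q.1 * sin q.2))
      / ((q.1 * cos q.2) ^ 2 + (q.1 * sin q.2) ^ 2))
      = ∫ q in Set.Ioi (0:ℝ) ×ˢ Set.Ioo (-π) π, F q := by
    apply setIntegral_congr_fun (measurableSet_Ioi.prod measurableSet_Ioo)
    intro q hq
    have hq0 : q.1 ≠ 0 := ne_of_gt hq.1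
    have : (q.1 * cos q.2) ^ 2 + (q.1 * sin q.2) ^ 2 = q.1 ^ 2 := by
      rw [mul_pow, mul_pow, ← mul_add, cos_sq_add_sin_sq, mul_one]
    simp only [this, hF]
    field_simp
  refine e.trans ?_
  rw [Measure.volume_eq_prod, setIntegral_prod F hon]
  have inner : ∀ r ∈ Set.Ioi (0:ℝ), ∫ t in Set.Ioo (-π) π, F (r, t) = 0 := by
    intro r hr
    have hr0 : r ≠ 0 := ne_of_gt hr
    have hd : ∀ t, HasDerivAt (fun t => r⁻¹ * g (r * cos t, r * sin t)) (F (r, t)) t := by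
      intro t
      have h : HasDerivAt (fun t : ℝ => ((r * cos t, r * sin t) : ℝ × ℝ))
          (r * -sin t, r * cos t) t :=
        ((hasDerivAt_cos t).const_mul r).prodMk ((hasDerivAt_sin t).const_mul r)
      have := ((hg.differentiable one_ne_zero) (r * cos t, r * sin t)).hasFDerivAt.comp_hasDerivAt t h
      rw [fd_split] at this
      have e2 : F (r, t) = r⁻¹ * (r * -sin t * pd1 g (r * cos t, r * sin t)
          + r * cos t * pd2 g (r * cos t, r * sin t)) := by
        change -sin t * pd1 g (r * cos t, r * sin t) + cos t * pd2 g (r * cos t, r * sin t) = _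
        field_simp
      rw [e2]
      exact this.const_mul r⁻¹
    rw [← integral_Ioc_eq_integral_Ioo, ← intervalIntegral.integral_of_le (by linarith [pi_pos]),
      intervalIntegral.integral_eq_sub_of_hasDerivAt (fun t _ => hd t)
        ((by fun_prop : Continuous fun t => F (r, t)).intervalIntegrable _ _)]
    simp
  rw [setIntegral_congr_fun measurableSet_Ioi inner]
  simp


/-- First component of the Biot-Savart kernel. -/
def ker1 (z : ℝ × ℝ) : ℝ := (2 * π)⁻¹ * (-z.2 / (z.1 ^ 2 + z.2 ^ 2))

/-- Second component of the Biot-Savart kernel. -/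
def ker2 (z : ℝ × ℝ) : ℝ := (2 * π)⁻¹ * (z.1 / (z.1 ^ 2 + z.2 ^ 2))

/-- The Euclidean length on the plane. -/
def rad (z : ℝ × ℝ) : ℝ := √(z.1 ^ 2 + z.2 ^ 2)

lemma rad_sq (z : ℝ × ℝ) : rad z ^ 2 = z.1 ^ 2 + z.2 ^ 2 := Real.sq_sqrt (by positivity)

lemma rad_nonneg (z : ℝ × ℝ) : 0 ≤ rad z := Real.sqrt_nonneg _

lemma rad_cont : Continuous rad := by unfold rad; fun_prop

lemma fst_le_rad (z : ℝ × ℝ) : |z.1| ≤ rad z := Real.abs_le_sqrt (by nlinarith [sq_nonneg z.2])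

lemma snd_le_rad (z : ℝ × ℝ) : |z.2| ≤ rad z := Real.abs_le_sqrt (by nlinarith [sq_nonneg z.1])

lemma norm_le_rad (z : ℝ × ℝ) : ‖z‖ ≤ rad z := by
  rw [Prod.norm_def]; exact max_le (fst_le_rad z) (snd_le_rad z)

lemma inv_two_pi : 0 < (2 * π)⁻¹ ∧ (2 * π)⁻¹ ≤ 1 := by
  constructor
  · positivity
  · apply inv_le_one_of_one_le₀; linarith [pi_gt_three]

lemma ker1_cx (z : ℝ × ℝ) : ker1 z = (2 * π)⁻¹ * ((⟨z.1, z.2⟩ : ℂ)⁻¹).im := by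
  simp [ker1, Complex.inv_im, Complex.normSq_apply, sq]

lemma ker2_cx (z : ℝ × ℝ) : ker2 z = (2 * π)⁻¹ * ((⟨z.1, z.2⟩ : ℂ)⁻¹).re := by
  simp [ker2, Complex.inv_re, Complex.normSq_apply, sq]

lemma rad_cx (z : ℝ × ℝ) : rad z = ‖(⟨z.1, z.2⟩ : ℂ)‖ := by
  rw [Complex.norm_def, rad, Complex.normSq_apply, sq, sq]

lemma ker1_le (z : ℝ × ℝ) : |ker1 z| ≤ (rad z)⁻¹ := by
  rw [ker1_cx, rad_cx, ← norm_inv, abs_mul, abs_of_pos inv_two_pi.1]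
  have := Complex.abs_im_le_norm ((⟨z.1, z.2⟩ : ℂ)⁻¹)
  nlinarith [inv_two_pi, norm_nonneg ((⟨z.1, z.2⟩ : ℂ)⁻¹)]

lemma ker2_le (z : ℝ × ℝ) : |ker2 z| ≤ (rad z)⁻¹ := by
  rw [ker2_cx, rad_cx, ← norm_inv, abs_mul, abs_of_pos inv_two_pi.1]
  have := Complex.abs_re_le_norm ((⟨z.1, z.2⟩ : ℂ)⁻¹)
  nlinarith [inv_two_pi, norm_nonneg ((⟨z.1, z.2⟩ : ℂ)⁻¹)]

lemma rad_inv_le (z : ℝ × ℝ) : (rad z)⁻¹ ≤ 1 * ‖z‖ ^ (-1 : ℝ) := by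
  rw [one_mul, Real.rpow_neg_one]
  rcases eq_or_ne z 0 with rfl | h
  · simp [rad]
  · exact inv_anti₀ (norm_pos_iff.2 h) (norm_le_rad z)

lemma ker1_loc : LocallyIntegrable ker1 := by
  apply locallyIntegrable_of_norm_le_rpow (C := 1) (α := 1) (by simp) (by simp)
  · exact Filter.Eventually.of_forall fun z => (ker1_le z).trans (rad_inv_le z)
  · have : Measurable ker1 := by unfold ker1; fun_prop
    exact this.aestronglyMeasurable

lemma ker2_loc : LocallyIntegrable ker2 := by
  apply locallyIntegrable_of_norm_le_rpow (C := 1) (α := 1) (by simp) (by simp)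
  · exact Filter.Eventually.of_forall fun z => (ker2_le z).trans (rad_inv_le z)
  · have : Measurable ker2 := by unfold ker2; fun_prop
    exact this.aestronglyMeasurable

lemma cx_far {a b : ℂ} (ha : 1 ≤ ‖a‖) (hb : ‖b‖ ≤ 1/2) :
    ‖(a - b)⁻¹ - a⁻¹‖ ≤ (‖a‖ ^ 2)⁻¹ := by
  have h1 : ‖a‖ / 2 ≤ ‖a - b‖ := by have := norm_sub_norm_le a b; linarith
  have ha0 : a ≠ 0 := norm_pos_iff.1 (by linarith)
  have hab : a - b ≠ 0 := norm_pos_iff.1 (by linarith)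
  have : (a - b)⁻¹ - a⁻¹ = b * ((a - b)⁻¹ * a⁻¹) := by field_simp; ring
  rw [this, norm_mul, norm_mul, norm_inv, norm_inv]
  have h2 : ‖a - b‖⁻¹ ≤ (‖a‖ / 2)⁻¹ := inv_anti₀ (by linarith) h1
  calc ‖b‖ * (‖a - b‖⁻¹ * ‖a‖⁻¹) ≤ (1/2) * ((‖a‖ / 2)⁻¹ * ‖a‖⁻¹) := by gcongr
    _ = _ := by field_simp

lemma ker1_far {z t : ℝ × ℝ} (hz : 1 ≤ rad z) (ht : rad t ≤ 1/2) :
    |ker1 (z - t) - ker1 z| ≤ (rad z ^ 2)⁻¹ := by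
  have h := cx_far (a := ⟨z.1, z.2⟩) (b := ⟨t.1, t.2⟩) (by rwa [← rad_cx]) (by rwa [← rad_cx])
  rw [← rad_cx] at h
  have e : (⟨(z - t).1, (z - t).2⟩ : ℂ) = ⟨z.1, z.2⟩ - ⟨t.1, t.2⟩ :=
    Complex.ext (by simp) (by simp)
  rw [ker1_cx, ker1_cx, e, ← mul_sub, ← Complex.sub_im, abs_mul, abs_of_pos inv_two_pi.1]
  have h2 := (Complex.abs_im_le_norm _).trans h
  nlinarith [inv_two_pi, abs_nonneg (((⟨z.1, z.2⟩ : ℂ) - ⟨t.1, t.2⟩)⁻¹ - (⟨z.1, z.2⟩ : ℂ)⁻¹).im]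

lemma ker2_far {z t : ℝ × ℝ} (hz : 1 ≤ rad z) (ht : rad t ≤ 1/2) :
    |ker2 (z - t) - ker2 z| ≤ (rad z ^ 2)⁻¹ := by
  have h := cx_far (a := ⟨z.1, z.2⟩) (b := ⟨t.1, t.2⟩) (by rwa [← rad_cx]) (by rwa [← rad_cx])
  rw [← rad_cx] at h
  have e : (⟨(z - t).1, (z - t).2⟩ : ℂ) = ⟨z.1, z.2⟩ - ⟨t.1, t.2⟩ :=
    Complex.ext (by simp) (by simp)
  rw [ker2_cx, ker2_cx, e, ← mul_sub, ← Complex.sub_re, abs_mul, abs_of_pos inv_two_pi.1]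
  have h2 := (Complex.abs_re_le_norm _).trans h
  nlinarith [inv_two_pi, abs_nonneg (((⟨z.1, z.2⟩ : ℂ) - ⟨t.1, t.2⟩)⁻¹ - (⟨z.1, z.2⟩ : ℂ)⁻¹).re]

/-- Convolution of a kernel with a profile. -/
def cv (k P : ℝ × ℝ → ℝ) : ℝ × ℝ → ℝ :=
  convolution k P (ContinuousLinearMap.mul ℝ ℝ) volume

lemma cv_cd {k P : ℝ × ℝ → ℝ} (hk : LocallyIntegrable k) (hP : ContDiff ℝ 2 P)
    (hs : HasCompactSupport P) : ContDiff ℝ 2 (cv k P) :=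
  hs.contDiff_convolution_right _ hk hP

lemma cv_fderiv {k P : ℝ × ℝ → ℝ} (hk : LocallyIntegrable k) (hP : ContDiff ℝ 2 P)
    (hs : HasCompactSupport P) (z v : ℝ × ℝ) :
    fderiv ℝ (cv k P) z v = ∫ t, k t * fderiv ℝ P (z - t) v := by
  have hP1 := hP.of_le (m := 1) (by norm_num)
  have h := hs.hasFDerivAt_convolution_right (ContinuousLinearMap.mul ℝ ℝ) hk hP1 z
  rw [show fderiv ℝ (cv k P) z = _ from h.fderiv, convolution_precompR_apply _ hk (hs.fderiv ℝ)
    (hP1.continuous_fderiv one_ne_zero)]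
  rfl

lemma cv_int {k P : ℝ × ℝ → ℝ} (hk : LocallyIntegrable k) (hP : Continuous P)
    (hs : HasCompactSupport P) (z : ℝ × ℝ) : Integrable fun t => k t * P (z - t) :=
  hs.convolutionExists_right (ContinuousLinearMap.mul ℝ ℝ) hk hP z

lemma cv_far {k P : ℝ × ℝ → ℝ} (hk : LocallyIntegrable k) (hP : Continuous P)
    (hs : HasCompactSupport P) (hP0 : ∀ z, 0 ≤ P z) (hsup : ∀ z, P z ≠ 0 → rad z < 1/2)
    (hi : ∫ z, P z = 1) {z : ℝ × ℝ}
    (hfar : ∀ t, rad t ≤ 1/2 → |k (z - t) - k z| ≤ (rad z ^ 2)⁻¹) :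
    |cv k P z - k z| ≤ (rad z ^ 2)⁻¹ := by
  have hPi : Integrable P := hP.integrable_of_hasCompactSupport hs
  have h1 : Integrable fun t => k (z - t) * P t := by
    have := (cv_int hk hP hs z).comp_sub_left z
    simpa using this
  have e : cv k P z - k z = ∫ t, (k (z - t) - k z) * P t := by
    simp_rw [sub_mul]
    rw [integral_sub h1 (hPi.const_mul _), integral_const_mul, hi, mul_one]
    rw [cv, convolution_eq_swap]; rfl
  rw [e, ← Real.norm_eq_abs]
  refine (norm_integral_le_of_norm_le (hPi.const_mul (rad z ^ 2)⁻¹)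
    (Filter.Eventually.of_forall fun t => ?_)).trans (by rw [integral_const_mul, hi, mul_one])
  rw [norm_mul, Real.norm_eq_abs, Real.norm_eq_abs, abs_of_nonneg (hP0 t)]
  by_cases h : P t = 0
  · simp [h]
  · exact mul_le_mul_of_nonneg_right (hfar t (hsup t h).le) (hP0 t)

lemma cv_bd {V k : ℝ × ℝ → ℝ} (hV : Continuous V) (hk : ∀ z, |k z| ≤ (rad z)⁻¹)
    (hfar : ∀ z, 1 ≤ rad z → |V z - k z| ≤ (rad z ^ 2)⁻¹) :
    ∃ A, 2 ≤ A ∧ ∀ z, |V z| ≤ A ∧ |V z| * rad z ≤ A := by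
  have hK : IsCompact (Set.Icc (-1:ℝ) 1 ×ˢ Set.Icc (-1:ℝ) 1) := isCompact_Icc.prod isCompact_Icc
  obtain ⟨B, hB⟩ := hK.exists_bound_of_continuousOn hV.continuousOn
  refine ⟨max B 2, le_max_right _ _, fun z => ?_⟩
  rcases le_or_gt 1 (rad z) with h | h
  · have h1 := hfar z h
    have h2 := hk z
    have h3 : |V z| ≤ 2 * (rad z)⁻¹ := by
      have := abs_add_le (V z - k z) (k z)
      rw [sub_add_cancel] at this
      have h4 : (rad z ^ 2)⁻¹ ≤ (rad z)⁻¹ := inv_anti₀ (by linarith) (by nlinarith)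
      linarith
    have h5 : (rad z)⁻¹ ≤ 1 := inv_le_one_of_one_le₀ h
    refine ⟨by linarith [le_max_right B 2], ?_⟩
    calc |V z| * rad z ≤ 2 * (rad z)⁻¹ * rad z := by gcongr
      _ = 2 := by field_simp
      _ ≤ _ := le_max_right _ _
  · have h1 : |V z| ≤ B := by
      apply hB
      have a1 := abs_le.1 ((fst_le_rad z).trans h.le)
      have a2 := abs_le.1 ((snd_le_rad z).trans h.le)
      exact ⟨a1, a2⟩
    refine ⟨h1.trans (le_max_left _ _), ?_⟩
    have := abs_nonneg (V z)
    calc |V z| * rad z ≤ |V z| * 1 := by gcongr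
      _ ≤ _ := by rw [mul_one]; exact h1.trans (le_max_left _ _)

lemma exists_V {P : ℝ × ℝ → ℝ} (hP : ContDiff ℝ 2 P) (hP0 : ∀ z, 0 ≤ P z)
    (hsup : ∀ z, P z ≠ 0 → rad z < 1/2) (hi : ∫ z, P z = 1) :
    ∃ (V1 V2 : ℝ × ℝ → ℝ) (A : ℝ), 2 ≤ A ∧ ContDiff ℝ 2 V1 ∧ ContDiff ℝ 2 V2 ∧
      (∀ z, pd1 V1 z + pd2 V2 z = 0) ∧ (∀ z, pd1 V2 z - pd2 V1 z = P z) ∧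
      (∀ z, |V1 z| * rad z ≤ A) ∧ (∀ z, |V2 z| ≤ A ∧ |V2 z| * rad z ≤ A) ∧
      (∀ z, 1 ≤ rad z → |V2 z - ker2 z| ≤ (rad z ^ 2)⁻¹) := by
  have hs : HasCompactSupport P := by
    apply HasCompactSupport.of_support_subset_isCompact
      (K := Set.Icc (-1:ℝ) 1 ×ˢ Set.Icc (-1:ℝ) 1) (isCompact_Icc.prod isCompact_Icc)
    intro z hz
    have h := hsup z hz
    exact ⟨abs_le.1 (by linarith [fst_le_rad z]), abs_le.1 (by linarith [snd_le_rad z])⟩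
  have hP1 := hP.of_le (m := 1) (by norm_num)
  have c1 := cv_cd ker1_loc hP hs
  have c2 := cv_cd ker2_loc hP hs
  have f1 : ∀ z, 1 ≤ rad z → |cv ker1 P z - ker1 z| ≤ (rad z ^ 2)⁻¹ := fun z hz =>
    cv_far ker1_loc hP.continuous hs hP0 hsup hi (fun t ht => ker1_far hz ht)
  have f2 : ∀ z, 1 ≤ rad z → |cv ker2 P z - ker2 z| ≤ (rad z ^ 2)⁻¹ := fun z hz =>
    cv_far ker2_loc hP.continuous hs hP0 hsup hi (fun t ht => ker2_far hz ht)
  obtain ⟨A1, hA1, hV1⟩ := cv_bd c1.continuous ker1_le f1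
  obtain ⟨A2, hA2, hV2⟩ := cv_bd c2.continuous ker2_le f2
  have hdP := hP.differentiable two_ne_zero
  have i1 : ∀ {k : ℝ × ℝ → ℝ}, LocallyIntegrable k → ∀ z v,
      Integrable fun t => k t * fderiv ℝ P (z - t) v := fun hk z v =>
    cv_int (P := fun y => fderiv ℝ P y v) hk
      ((hP1.continuous_fderiv one_ne_zero).clm_apply continuous_const) (hs.fderiv_apply ℝ v) z
  have hg : ∀ z, ContDiff ℝ 1 (fun t => P (z - t)) := fun z => by fun_prop
  have hgs : ∀ z, HasCompactSupport (fun t => P (z - t)) := fun z =>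
    hs.comp_homeomorph (Homeomorph.subLeft z)
  have hgd : ∀ z t v, fderiv ℝ (fun t => P (z - t)) t v = - fderiv ℝ P (z - t) v := by
    intro z t v
    have h : HasFDerivAt (fun t : ℝ × ℝ => z - t) (-ContinuousLinearMap.id ℝ (ℝ × ℝ)) t :=
      (hasFDerivAt_id t).const_sub z
    have := (hdP (z - t)).hasFDerivAt.comp t h
    rw [show fderiv ℝ (fun t => P (z - t)) t = _ from this.fderiv]
    simp
  refine ⟨cv ker1 P, cv ker2 P, max A1 A2, hA1.trans (le_max_left _ _), c1, c2, ?_, ?_, ?_, ?_, f2⟩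
  · intro z
    have h := angular_id (hg z) (hgs z)
    simp only [pd1, pd2, hgd] at h
    simp only [pd1, pd2]
    rw [cv_fderiv ker1_loc hP hs, cv_fderiv ker2_loc hP hs, ← integral_add (i1 ker1_loc _ _)
      (i1 ker2_loc _ _)]
    rw [← neg_eq_zero, ← integral_neg]
    refine Eq.trans ?_ (mul_eq_zero_of_right (2 * π)⁻¹ h)
    rw [← integral_const_mul]
    congr 1; ext t; simp only [ker1, ker2]; ring
  · intro z
    have h := radial_id (hg z) (hgs z)
    simp only [pd1, pd2, hgd, sub_zero] at h
    simp only [pd1, pd2]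
    rw [cv_fderiv ker1_loc hP hs, cv_fderiv ker2_loc hP hs, ← integral_sub (i1 ker2_loc _ _)
      (i1 ker1_loc _ _)]
    have : P z = -(2 * π)⁻¹ * (-(2 * π) * P z) := by field_simp
    rw [this, ← h, ← integral_const_mul]
    congr 1; ext t; simp only [ker1, ker2]; ring
  · exact fun z => (hV1 z).2.trans (le_max_left _ _)
  · exact fun z => ⟨(hV2 z).1.trans (le_max_right _ _), (hV2 z).2.trans (le_max_right _ _)⟩


/-- A smooth cutoff. -/
def cut (z : ℝ × ℝ) : ℝ := Real.smoothTransition ((1/16 - (z.1 ^ 2 + z.2 ^ 2)) * (64/3))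

lemma cut_cd : ContDiff ℝ 2 cut := by
  unfold cut
  exact Real.smoothTransition.contDiff.comp (by fun_prop)

lemma cut_nonneg (z : ℝ × ℝ) : 0 ≤ cut z := Real.smoothTransition.nonneg _

lemma cut_le_one (z : ℝ × ℝ) : cut z ≤ 1 := Real.smoothTransition.le_one _

lemma cut_one {z : ℝ × ℝ} (h : rad z ≤ 1/8) : cut z = 1 := by
  apply Real.smoothTransition.one_of_one_le
  rw [← rad_sq]; nlinarith [rad_nonneg z]

lemma cut_zero {z : ℝ × ℝ} (h : 1/4 ≤ rad z) : cut z = 0 := by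
  apply Real.smoothTransition.zero_of_nonpos
  rw [← rad_sq]; nlinarith [rad_nonneg z]

lemma cut_zero' {z : ℝ × ℝ} (h : z ∉ qq) : cut z = 0 := by
  apply cut_zero
  by_contra h'
  push Not at h'
  apply h
  exact ⟨abs_le.1 (by linarith [fst_le_rad z]), abs_le.1 (by linarith [snd_le_rad z])⟩

/-- Rescaled velocity. -/
def sc (V : ℝ × ℝ → ℝ) (ε : ℝ) (z : ℝ × ℝ) : ℝ := ε⁻¹ * V (ε⁻¹ • z)

lemma rad_smul {c : ℝ} (hc : 0 ≤ c) (z : ℝ × ℝ) : rad (c • z) = c * rad z := by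
  simp only [rad, Prod.smul_fst, Prod.smul_snd, smul_eq_mul]
  rw [mul_pow, mul_pow, ← mul_add, Real.sqrt_mul (by positivity), Real.sqrt_sq hc]

lemma sc_bd {V : ℝ × ℝ → ℝ} {A ε : ℝ} (hε : 0 < ε) {z : ℝ × ℝ}
    (h : |V (ε⁻¹ • z)| * rad (ε⁻¹ • z) ≤ A) : |sc V ε z| * rad z ≤ A := by
  rw [rad_smul (by positivity)] at h
  rw [sc, abs_mul, abs_of_pos (inv_pos.2 hε)]
  linarith

lemma ker2_smul {c : ℝ} (hc : 0 < c) (z : ℝ × ℝ) : ker2 (c • z) = c⁻¹ * ker2 z := by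
  simp only [ker2, Prod.smul_fst, Prod.smul_snd, smul_eq_mul]
  rw [mul_pow, mul_pow, ← mul_add]
  field_simp

lemma rad_polar {r : ℝ} (hr : 0 ≤ r) (t : ℝ) : rad (r * cos t, r * sin t) = r := by
  simp only [rad]
  rw [mul_pow, mul_pow, ← mul_add, cos_sq_add_sin_sq, mul_one, Real.sqrt_sq hr]

lemma int_psi {ε : ℝ} (hε : 0 < ε) :
    IntegrableOn (fun r : ℝ => 1 + 2 * (ε / (r ^ 2 + ε ^ 2))) (Set.Ioo 0 1) ∧
    ∫ r in Set.Ioo (0:ℝ) 1, (1 + 2 * (ε / (r ^ 2 + ε ^ 2))) ≤ 1 + π := by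
  have hc : Continuous (fun r : ℝ => 1 + 2 * (ε / (r ^ 2 + ε ^ 2))) := by
    have : ∀ r : ℝ, r ^ 2 + ε ^ 2 ≠ 0 := fun r => by positivity
    fun_prop (disch := assumption)
  refine ⟨(hc.continuousOn.integrableOn_compact isCompact_Icc).mono_set Set.Ioo_subset_Icc_self, ?_⟩
  rw [← integral_Ioc_eq_integral_Ioo, ← intervalIntegral.integral_of_le zero_le_one]
  have hd : ∀ r : ℝ, HasDerivAt (fun r => r + 2 * arctan (r / ε)) (1 + 2 * (ε / (r ^ 2 + ε ^ 2))) r := by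
    intro r
    have h1 := ((hasDerivAt_id r).div_const ε).arctan
    have h2 := (hasDerivAt_id r).add (h1.const_mul 2)
    have e : (1 + 2 * (ε / (r ^ 2 + ε ^ 2))) = 1 + 2 * (1 / (1 + (id r / ε) ^ 2) * (1 / ε)) := by
      simp only [id]; field_simp; ring
    rw [e]; exact h2
  rw [intervalIntegral.integral_eq_sub_of_hasDerivAt (fun r _ => hd r) (hc.intervalIntegrable _ _)]
  simp
  have := arctan_lt_pi_div_two (ε⁻¹)
  linarith

set_option maxHeartbeats 1600000 in
/-- Asymptotics of the main term. -/
lemma main_term {V : ℝ × ℝ → ℝ} {A M : ℝ} (hA : 2 ≤ A) (hM : 0 ≤ M) (hV : Continuous V)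
    (hb : ∀ z, |V z| ≤ A ∧ |V z| * rad z ≤ A)
    (hfar : ∀ z, 1 ≤ rad z → |V z - ker2 z| ≤ (rad z ^ 2)⁻¹)
    {h : ℝ → ℝ} (hc : Continuous h) (h0 : ∀ s, |h s| ≤ M) (h1 : ∀ c s, |h (c + s) - h c| ≤ M * |s|)
    {ε : ℝ} (hε : 0 < ε) (hε1 : ε ≤ 1/4) (c : ℝ) :
    |(∫ z in qq, (cut z * sc V ε z) ^ 2 * h (c + z.2)) - h c / (4 * π) * log (1 / ε)|
      ≤ M * (A ^ 2 + A + 10) * ((1 + π) * (2 * π)) := by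
  set S := Set.Ioi (0:ℝ) ×ˢ Set.Ioo (-π) π with hS
  have hSm : MeasurableSet S := measurableSet_Ioi.prod measurableSet_Ioo
  have hcut := cut_cd.continuous
  have hsc : Continuous (sc V ε) := by unfold sc; fun_prop
  set F : ℝ × ℝ → ℝ := fun q => q.1 * ((cut (q.1 * cos q.2, q.1 * sin q.2) *
    sc V ε (q.1 * cos q.2, q.1 * sin q.2)) ^ 2 * h (c + q.1 * sin q.2)) with hF
  have hFc : Continuous F := by fun_prop
  have e1 : ∫ z in qq, (cut z * sc V ε z) ^ 2 * h (c + z.2) = ∫ q in S, F q := by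
    rw [setIntegral_eq_integral_of_forall_compl_eq_zero
      (fun z hz => by simp [cut_zero' hz]), polar_int]
  have hFi : IntegrableOn F S := polar_on hFc (R := 1) (fun q hq => by
    have : cut (q.1 * cos q.2, q.1 * sin q.2) = 0 :=
      cut_zero (by rw [rad_polar (by linarith)]; linarith)
    simp [hF, this])
  set g1 : ℝ → ℝ := (Set.Ioo ε 1).indicator (fun r => r⁻¹) with hg1
  set g2 : ℝ → ℝ := fun t => h c * ((4 * π ^ 2)⁻¹ * cos t ^ 2) with hg2
  have hio : IntegrableOn (fun r : ℝ => r⁻¹) (Set.Ioo ε 1) := by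
    have : ContinuousOn (fun r : ℝ => r⁻¹) (Set.Icc ε 1) :=
      continuousOn_inv₀.mono fun r hr => ne_of_gt (lt_of_lt_of_le hε hr.1)
    exact (this.integrableOn_compact isCompact_Icc).mono_set Set.Ioo_subset_Icc_self
  have i1 : IntegrableOn g1 (Set.Ioi 0) := by
    have : Integrable g1 := (integrable_indicator_iff measurableSet_Ioo).2 hio
    exact this.integrableOn
  have i2 : IntegrableOn g2 (Set.Ioo (-π) π) :=
    ((by fun_prop : Continuous g2).continuousOn.integrableOn_compact
      (isCompact_Icc (a := -π) (b := π))).mono_set Set.Ioo_subset_Icc_self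
  have v1 : ∫ r in Set.Ioi (0:ℝ), g1 r = log (1 / ε) := by
    rw [hg1, setIntegral_indicator measurableSet_Ioo]
    have : Set.Ioi (0:ℝ) ∩ Set.Ioo ε 1 = Set.Ioo ε 1 :=
      Set.inter_eq_right.2 fun r hr => lt_trans hε hr.1
    rw [this, ← integral_Ioc_eq_integral_Ioo, ← intervalIntegral.integral_of_le (by linarith),
      integral_inv_of_pos hε one_pos]
  have v2 : ∫ t in Set.Ioo (-π) π, g2 t = h c / (4 * π) := by
    rw [← integral_Ioc_eq_integral_Ioo, ← intervalIntegral.integral_of_le (by linarith [pi_pos])]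
    simp only [hg2, intervalIntegral.integral_const_mul, integral_cos_sq]
    simp; field_simp
  have e2 : ∫ q in S, g1 q.1 * g2 q.2 = h c / (4 * π) * log (1 / ε) := by
    rw [hS, Measure.volume_eq_prod, setIntegral_prod_mul, v1, v2, mul_comm]
  have hGi : IntegrableOn (fun q : ℝ × ℝ => g1 q.1 * g2 q.2) S := by
    rw [IntegrableOn, hS, Measure.volume_eq_prod, ← Measure.prod_restrict]
    exact Integrable.mul_prod i1 i2
  rw [e1, ← e2, ← integral_sub hFi hGi, ← Real.norm_eq_abs]
  set ψ : ℝ → ℝ := (Set.Ioo (0:ℝ) 1).indicator (fun r => 1 + 2 * (ε / (r ^ 2 + ε ^ 2))) with hψ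
  obtain ⟨p1, p2⟩ := int_psi hε
  have i3 : IntegrableOn ψ (Set.Ioi 0) := by
    have : Integrable ψ := (integrable_indicator_iff measurableSet_Ioo).2 p1
    exact this.integrableOn
  have hψi : IntegrableOn (fun q : ℝ × ℝ => ψ q.1 * 1) S := by
    rw [IntegrableOn, hS, Measure.volume_eq_prod, ← Measure.prod_restrict]
    exact Integrable.mul_prod i3 (integrable_const 1)
  have e3 : ∫ q in S, ψ q.1 * 1 ≤ (1 + π) * (2 * π) := by
    rw [hS, Measure.volume_eq_prod, setIntegral_prod_mul ψ (fun _ => 1)]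
    have : Set.Ioi (0:ℝ) ∩ Set.Ioo 0 1 = Set.Ioo 0 1 :=
      Set.inter_eq_right.2 fun r hr => hr.1
    rw [hψ, setIntegral_indicator measurableSet_Ioo, this]
    have e : ∫ _ in Set.Ioo (-π) π, (1:ℝ) = 2 * π := by simp [pi_pos.le]; ring
    rw [e]
    gcongr
  have key : ∀ q ∈ S, ‖F q - g1 q.1 * g2 q.2‖ ≤ M * (A ^ 2 + A + 10) * (ψ q.1 * 1) := by
    rintro ⟨r, t⟩ ⟨hr, -⟩
    have hr : 0 < r := hr
    rw [Real.norm_eq_abs, mul_one]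
    have hrad := rad_polar hr.le t
    set z : ℝ × ℝ := (r * cos t, r * sin t) with hz
    have hFq : F (r, t) = r * ((cut z * sc V ε z) ^ 2 * h (c + r * sin t)) := rfl
    have c0 := cut_nonneg z
    have c1 := cut_le_one z
    have c2 : cut z ^ 2 ≤ 1 := by nlinarith
    rcases le_or_gt 1 r with hr1 | hr1
    · have : cut z = 0 := cut_zero (by rw [hrad]; linarith)
      have h3 : g1 r = 0 := Set.indicator_of_notMem (fun h => by linarith [h.2]) _
      have h4 : ψ r = 0 := Set.indicator_of_notMem (fun h => by linarith [h.2]) _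
      simp only [hFq, this, h3, h4]; simp
    have h4 : ψ r = 1 + 2 * (ε / (r ^ 2 + ε ^ 2)) := Set.indicator_of_mem (show r ∈ Set.Ioo (0:ℝ) 1 from ⟨hr, hr1⟩) _
    rcases le_or_gt r ε with hre | hre
    · have h3 : g1 r = 0 := Set.indicator_of_notMem (fun h => by linarith [h.1]) _
      have hs : |sc V ε z| ≤ ε⁻¹ * A := by
        rw [sc, abs_mul, abs_of_pos (inv_pos.2 hε)]
        exact mul_le_mul_of_nonneg_left (hb _).1 (by positivity)
      have hs2 : sc V ε z ^ 2 ≤ (ε⁻¹ * A) ^ 2 := by rw [← sq_abs]; gcongr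
      have hb1 : |F (r, t)| ≤ r * ((1 * (ε⁻¹ * A) ^ 2) * M) := by
        rw [hFq, abs_mul, abs_of_pos hr, abs_mul, abs_of_nonneg (sq_nonneg _), mul_pow]
        gcongr
        exact h0 _
      have hb2 : ε⁻¹ ≤ 2 * (ε / (r ^ 2 + ε ^ 2)) := by
        rw [inv_eq_one_div, ← mul_div_assoc, div_le_div_iff₀ hε (by positivity)]
        nlinarith
      have hb3 : r * ((1 * (ε⁻¹ * A) ^ 2) * M) ≤ M * A ^ 2 * ε⁻¹ := by
        calc r * ((1 * (ε⁻¹ * A) ^ 2) * M) ≤ ε * ((1 * (ε⁻¹ * A) ^ 2) * M) := by gcongr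
          _ = M * A ^ 2 * ε⁻¹ := by field_simp
      simp only [h3, zero_mul, sub_zero, h4]
      refine hb1.trans (hb3.trans ?_)
      have : 0 ≤ A + 10 := by linarith
      calc M * A ^ 2 * ε⁻¹ ≤ M * (A ^ 2 + A + 10) * ε⁻¹ := by gcongr; nlinarith
        _ ≤ _ := by
          apply mul_le_mul_of_nonneg_left _ (by nlinarith [mul_nonneg hM (by nlinarith : 0 ≤ A ^ 2 + A + 10)])
          linarith
    · have h3 : g1 r = r⁻¹ := Set.indicator_of_mem (show r ∈ Set.Ioo ε 1 from ⟨hre, hr1⟩) _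
      have hk : ker2 z = (2 * π)⁻¹ * (cos t * r⁻¹) := by
        have : z.1 ^ 2 + z.2 ^ 2 = r ^ 2 := by rw [← rad_sq, hrad]
        rw [ker2, this, hz]; field_simp
      have hG : g1 r * g2 t = r * (ker2 z ^ 2 * h c) := by
        rw [h3, hk, hg2]; field_simp; ring
      have hkb : |ker2 z| ≤ r⁻¹ := by rw [← hrad]; exact ker2_le z
      have hsb : |sc V ε z| ≤ A * r⁻¹ := by
        have := sc_bd hε (hb (ε⁻¹ • z)).2
        rw [hrad] at this
        rw [← div_eq_mul_inv, le_div_iff₀ hr]; exact this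
      have hE : |sc V ε z - ker2 z| ≤ ε * (r ^ 2)⁻¹ := by
        have hh := hfar (ε⁻¹ • z) (by
          rw [rad_smul (by positivity), hrad, inv_mul_eq_div, le_div_iff₀ hε]; linarith)
        rw [rad_smul (by positivity), hrad, ker2_smul (by positivity)] at hh
        have : sc V ε z - ker2 z = ε⁻¹ * (V (ε⁻¹ • z) - ε⁻¹⁻¹ * ker2 z) := by
          rw [sc]; field_simp
        rw [this, abs_mul, abs_of_pos (inv_pos.2 hε)]
        calc ε⁻¹ * |V (ε⁻¹ • z) - ε⁻¹⁻¹ * ker2 z| ≤ ε⁻¹ * ((ε⁻¹ * r) ^ 2)⁻¹ := by gcongr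
          _ = _ := by field_simp
      set K := sc V ε z
      set k := ker2 z
      set χ := cut z
      have t1 : |K ^ 2 - k ^ 2| ≤ (ε * (r ^ 2)⁻¹) * ((A + 1) * r⁻¹) := by
        have : K ^ 2 - k ^ 2 = (K - k) * (K + k) := by ring
        rw [this, abs_mul]
        gcongr
        have := abs_add_le K k
        linarith
      have t2 : |χ ^ 2 * h (c + r * sin t) - h c| ≤ 9 * M * r := by
        have a1 : |h (c + r * sin t) - h c| ≤ M * r := by
          refine (h1 c (r * sin t)).trans ?_
          gcongr
          rw [abs_mul, abs_of_pos hr]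
          nlinarith [abs_sin_le_one t]
        have a2 : |(1 - χ ^ 2) * h c| ≤ 8 * M * r := by
          rcases le_or_gt r (1/8) with h8 | h8
          · have : χ = 1 := cut_one (by rw [hrad]; exact h8)
            rw [this]; simp; positivity
          · rw [abs_mul, abs_of_nonneg (by linarith : 0 ≤ 1 - χ ^ 2)]
            calc (1 - χ ^ 2) * |h c| ≤ 1 * M := by
                  gcongr
                  · nlinarith
                  · exact h0 c
              _ ≤ _ := by nlinarith
        have a3 : |χ ^ 2 * (h (c + r * sin t) - h c)| ≤ M * r := by
          rw [abs_mul, abs_of_nonneg (sq_nonneg _)]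
          calc χ ^ 2 * |h (c + r * sin t) - h c| ≤ 1 * (M * r) := by gcongr
            _ = _ := one_mul _
        have : χ ^ 2 * h (c + r * sin t) - h c
            = χ ^ 2 * (h (c + r * sin t) - h c) - (1 - χ ^ 2) * h c := by ring
        rw [this]
        have := abs_sub (χ ^ 2 * (h (c + r * sin t) - h c)) ((1 - χ ^ 2) * h c)
        linarith
      have t3 : F (r, t) - g1 r * g2 t = r * ((K ^ 2 - k ^ 2) * (χ ^ 2 * h (c + r * sin t))
          + k ^ 2 * (χ ^ 2 * h (c + r * sin t) - h c)) := by
        rw [hG, hFq]; ring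
      have t4 : |χ ^ 2 * h (c + r * sin t)| ≤ M := by
        rw [abs_mul, abs_of_nonneg (sq_nonneg _)]
        calc χ ^ 2 * |h (c + r * sin t)| ≤ 1 * M := by gcongr; exact h0 _
          _ = _ := one_mul _
      have t5 : k ^ 2 ≤ (r⁻¹) ^ 2 := by rw [← sq_abs]; gcongr
      have t6 : |F (r, t) - g1 r * g2 t| ≤ r * ((ε * (r ^ 2)⁻¹) * ((A + 1) * r⁻¹) * M
          + (r⁻¹) ^ 2 * (9 * M * r)) := by
        rw [t3, abs_mul, abs_of_pos hr]
        gcongr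
        refine (abs_add_le _ _).trans ?_
        rw [abs_mul, abs_mul (k ^ 2), abs_of_nonneg (sq_nonneg k)]
        gcongr
      have t7 : r * ((ε * (r ^ 2)⁻¹) * ((A + 1) * r⁻¹) * M + (r⁻¹) ^ 2 * (9 * M * r))
          = M * (A + 1) * (ε / r ^ 2) + 9 * M := by field_simp
      have t8 : ε / r ^ 2 ≤ 2 * (ε / (r ^ 2 + ε ^ 2)) := by
        rw [← mul_div_assoc, div_le_div_iff₀ (by positivity) (by positivity)]
        nlinarith [mul_pos hε hε, mul_pos hε hr]
      change |F (r, t) - g1 r * g2 t| ≤ M * (A ^ 2 + A + 10) * ψ r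
      rw [h4]
      refine t6.trans (t7.le.trans ?_)
      set y := ε / (r ^ 2 + ε ^ 2)
      have hy : 0 ≤ y := by positivity
      have hMA : 0 ≤ M * (A + 1) := mul_nonneg hM (by linarith)
      have b1 : M * (A + 1) * (ε / r ^ 2) ≤ M * (A + 1) * (2 * y) :=
        mul_le_mul_of_nonneg_left t8 hMA
      have b2 : M * (A + 1) ≤ M * (A ^ 2 + A + 10) := by
        apply mul_le_mul_of_nonneg_left _ hM; nlinarith
      have b3 : 9 * M ≤ M * (A ^ 2 + A + 10) := by
        rw [mul_comm]; apply mul_le_mul_of_nonneg_left _ hM; nlinarith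
      have b4 : M * (A + 1) * (2 * y) ≤ M * (A ^ 2 + A + 10) * (2 * y) := by gcongr
      linarith
  refine (norm_integral_le_of_norm_le (hψi.const_mul (M * (A ^ 2 + A + 10)))
    ((ae_restrict_iff' hSm).2 (Filter.Eventually.of_forall key))).trans ?_
  rw [integral_const_mul]
  apply mul_le_mul_of_nonneg_left e3
  have : 0 ≤ A ^ 2 + A + 10 := by nlinarith
  positivity


lemma sc_cd {V : ℝ × ℝ → ℝ} (hV : ContDiff ℝ 2 V) (ε : ℝ) : ContDiff ℝ 2 (sc V ε) := by
  unfold sc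
  exact contDiff_const.mul (hV.comp (contDiff_const_smul _))

lemma sc_fd {V : ℝ × ℝ → ℝ} (hV : ContDiff ℝ 2 V) (ε : ℝ) (z v : ℝ × ℝ) :
    fderiv ℝ (sc V ε) z v = ε⁻¹ ^ 2 * fderiv ℝ V (ε⁻¹ • z) v := by
  have h1 : HasFDerivAt (fun z : ℝ × ℝ => ε⁻¹ • z) (ε⁻¹ • ContinuousLinearMap.id ℝ (ℝ × ℝ)) z :=
    (hasFDerivAt_id z).const_smul ε⁻¹
  have h2 := ((hV.differentiable two_ne_zero (ε⁻¹ • z)).hasFDerivAt.comp z h1).const_smul ε⁻¹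
  have h3 : HasFDerivAt (sc V ε) _ z := h2
  rw [h3.fderiv]
  simp; ring

lemma cut_pd_zero {z : ℝ × ℝ} (h : rad z < 1/8) : pd1 cut z = 0 ∧ pd2 cut z = 0 := by
  have : cut =ᶠ[nhds z] fun _ => 1 := by
    have := (isOpen_lt rad_cont continuous_const).mem_nhds h
    filter_upwards [this] with y hy
    exact cut_one (le_of_lt hy)
  rw [pd1, pd2, this.fderiv_eq]
  simp

lemma cut_pd_bd : ∃ B : ℝ, 0 ≤ B ∧ ∀ z ∈ qq, |pd1 cut z| ≤ B ∧ |pd2 cut z| ≤ B := by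
  have hc := cut_cd.of_le (m := 1) (by norm_num)
  obtain ⟨B1, h1⟩ := qq_compact.exists_bound_of_continuousOn (pd1_cont hc).continuousOn
  obtain ⟨B2, h2⟩ := qq_compact.exists_bound_of_continuousOn (pd2_cont hc).continuousOn
  have h0 : (0:ℝ × ℝ) ∈ qq := by
    constructor <;> simp [iq]
  exact ⟨max B1 B2, (norm_nonneg _).trans ((h1 0 h0).trans (le_max_left _ _)), fun z hz =>
    ⟨(h1 z hz).trans (le_max_left _ _), (h2 z hz).trans (le_max_right _ _)⟩⟩

lemma rpow_iq {a : ℝ} (ha : -1 < a) : IntegrableOn (fun x : ℝ => |x| ^ a) iq := by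
  have h1 : IntervalIntegrable (fun x : ℝ => |x| ^ a) volume 0 (1/2) := by
    refine (intervalIntegral.intervalIntegrable_rpow' ha).congr ?_
    intro x hx
    rw [Set.uIoc_of_le (by norm_num)] at hx
    simp [abs_of_pos hx.1]
  have h2 : IntervalIntegrable (fun x : ℝ => |x| ^ a) volume (-(1/2)) 0 := by
    have := (IntervalIntegrable.iff_comp_neg (f := fun x : ℝ => |x| ^ a) (a := 0) (b := 1/2)).1 h1
    simp at this
    simpa using this.symm
  have := h2.trans h1
  rw [intervalIntegrable_iff_integrableOn_Icc_of_le (by norm_num)] at this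
  exact this

lemma cross_term : ∃ c0 c1 : ℝ, 0 ≤ c0 ∧ 0 ≤ c1 ∧ ∀ (f r : ℝ × ℝ → ℝ) (H : ℝ → ℝ) (A m D : ℝ),
    Continuous f → Continuous r → Continuous H → 0 ≤ A → (∀ z, |f z| * rad z ≤ A) →
    (∀ z ∈ qq, r z ^ 2 ≤ 2 * m ^ 2 + 2 * H z.2) → (∫ y in iq, H y ≤ D) →
    |∫ z in qq, f z * r z| ≤ A * c0 * (c1 + 2 * m ^ 2 + 2 * D) := by
  refine ⟨∫ x in iq, |x| ^ (-(3/4) : ℝ), ∫ x in iq, |x| ^ (-(1/2) : ℝ),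
    integral_nonneg fun x => by positivity, integral_nonneg fun x => by positivity, ?_⟩
  intro f r H A m D hf hr hH hA hfb hrb hHD
  have i1 := rpow_iq (a := -(3/4)) (by norm_num)
  have i2 := rpow_iq (a := -(1/2)) (by norm_num)
  set g1 : ℝ → ℝ := fun x => |x| ^ (-(3/4) : ℝ)
  set g2 : ℝ → ℝ := fun x => |x| ^ (-(1/2) : ℝ) + (2 * m ^ 2 + 2 * H x) with hg2
  have iH : IntegrableOn H iq := hH.continuousOn.integrableOn_compact iq_compact
  have ic : IntegrableOn (fun _ : ℝ => 2 * m ^ 2) iq :=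
    continuous_const.continuousOn.integrableOn_compact iq_compact
  have i4 : IntegrableOn (fun x => 2 * m ^ 2 + 2 * H x) iq := ic.add (iH.const_mul 2)
  have i3 : IntegrableOn g2 iq := i2.add i4
  have v3 : ∫ x in iq, g2 x = (∫ x in iq, |x| ^ (-(1/2) : ℝ)) + 2 * m ^ 2 + 2 * ∫ y in iq, H y := by
    rw [hg2, integral_add i2 i4, integral_add ic (iH.const_mul 2), integral_const_mul 2 H,
      setIntegral_const, vol_iq]
    simp; ring
  have hGi : IntegrableOn (fun q : ℝ × ℝ => g1 q.1 * g2 q.2) qq := by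
    rw [IntegrableOn, qq, Measure.volume_eq_prod, ← Measure.prod_restrict]
    exact Integrable.mul_prod i1 i3
  have e : ∫ q in qq, g1 q.1 * g2 q.2 = (∫ x in iq, g1 x) * ∫ x in iq, g2 x := by
    rw [qq, Measure.volume_eq_prod, setIntegral_prod_mul]
  have ae0 : ∀ᵐ x : ℝ, x ≠ 0 := by simp [ae_iff]
  have hx : ∀ᵐ z : ℝ × ℝ, z.1 ≠ 0 := by
    rw [Measure.volume_eq_prod]; exact Measure.quasiMeasurePreserving_fst.ae ae0
  have hy : ∀ᵐ z : ℝ × ℝ, z.2 ≠ 0 := by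
    rw [Measure.volume_eq_prod]; exact Measure.quasiMeasurePreserving_snd.ae ae0
  have key : ∀ᵐ z ∂(volume.restrict qq), ‖f z * r z‖ ≤ A * (g1 z.1 * g2 z.2) := by
    rw [ae_restrict_iff' qq_meas]
    filter_upwards [hx, hy] with z hx hy hz
    have hx' := abs_pos.2 hx
    have hy' := abs_pos.2 hy
    have hR : 0 < rad z := hx'.trans_le (fst_le_rad z)
    have a1 : |f z| ≤ A * (rad z)⁻¹ := by
      rw [← div_eq_mul_inv, le_div_iff₀ hR]; exact hfb z
    have a2 : (rad z)⁻¹ ≤ |z.1| ^ (-(3/4) : ℝ) * |z.2| ^ (-(1/4) : ℝ) := by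
      have : (rad z)⁻¹ = rad z ^ (-(3/4) : ℝ) * rad z ^ (-(1/4) : ℝ) := by
        rw [← rpow_add hR, ← rpow_neg_one]; norm_num
      rw [this]
      exact mul_le_mul (rpow_le_rpow_of_nonpos hx' (fst_le_rad z) (by norm_num))
        (rpow_le_rpow_of_nonpos hy' (snd_le_rad z) (by norm_num)) (by positivity) (by positivity)
    have a3 : |z.2| ^ (-(1/4) : ℝ) * |r z| ≤ g2 z.2 := by
      have b1 : (|z.2| ^ (-(1/4) : ℝ)) ^ 2 = |z.2| ^ (-(1/2) : ℝ) := by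
        rw [← rpow_natCast, ← rpow_mul hy'.le]; norm_num
      have b2 := hrb z hz
      rw [← sq_abs] at b2
      simp only [hg2]
      rw [← b1]
      nlinarith [sq_nonneg (|z.2| ^ (-(1/4) : ℝ) - |r z|), sq_nonneg (|z.2| ^ (-(1/4) : ℝ) + |r z|)]
    rw [norm_mul, Real.norm_eq_abs, Real.norm_eq_abs]
    calc |f z| * |r z| ≤ (A * (|z.1| ^ (-(3/4) : ℝ) * |z.2| ^ (-(1/4) : ℝ))) * |r z| := by
          gcongr; exact a1.trans (by gcongr)
      _ = A * (g1 z.1 * (|z.2| ^ (-(1/4) : ℝ) * |r z|)) := by simp only [g1]; ring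
      _ ≤ _ := by gcongr
  have := norm_integral_le_of_norm_le (hGi.const_mul A) key
  rw [integral_const_mul, e, v3, Real.norm_eq_abs] at this
  refine this.trans ?_
  rw [mul_assoc]
  gcongr


lemma face_cut1 (y : ℝ) : cut (1/2, y) = 0 ∧ cut (-(1/2), y) = 0 := by
  constructor <;> apply cut_zero <;> refine le_trans ?_ (fst_le_rad _) <;> norm_num [abs_of_pos]

lemma face_cut2 (x : ℝ) : cut (x, 1/2) = 0 ∧ cut (x, -(1/2)) = 0 := by
  constructor <;> apply cut_zero <;> refine le_trans ?_ (snd_le_rad _) <;> norm_num [abs_of_pos]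

lemma cut_prod_bd {K d : ℝ × ℝ → ℝ} {A B : ℝ} (hA : 0 ≤ A) (hB : 0 ≤ B)
    (hK : ∀ z, |K z| * rad z ≤ A) {z : ℝ × ℝ} (hd : |d z| ≤ B) (h0 : rad z < 1/8 → d z = 0) :
    |d z * K z| ≤ 8 * A * B := by
  rcases lt_or_ge (rad z) (1/8) with h | h
  · rw [h0 h]; simp; positivity
  · rw [abs_mul]
    have h1 : |K z| ≤ 8 * A := by nlinarith [hK z, abs_nonneg (K z)]
    calc |d z| * |K z| ≤ B * (8 * A) := by gcongr
      _ = _ := by ring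

/-- Line means from the divergence. -/
lemma line_mean {a b : ℝ × ℝ → ℝ} (ha : ContDiff ℝ 2 a) (hb : ContDiff ℝ 2 b)
    (ha1 : ∀ y, a (1/2, y) = a (-(1/2), y)) {m : ℝ}
    (hdiv : ∀ z ∈ qq, |pd1 a z + pd2 b z| ≤ m) (h0 : ∫ x in iq, b (x, 1/2) = 0)
    {y : ℝ} (hy : y ∈ iq) : |∫ x in iq, b (x, y)| ≤ m := by
  have h := div_rect (ha.of_le (m := 1) (by norm_num)) (hb.of_le (m := 1) (by norm_num))
    (-(1/2)) (1/2) y (1/2)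
  simp_rw [ha1] at h
  rw [← int_iq (fun x => b (x, 1/2)), h0, ← int_iq (fun x => b (x, y))] at h
  have e : ∫ x in iq, b (x, y) = -(∫ x in (-(1/2):ℝ)..(1/2), ∫ y in y..(1/2),
    pd1 a (x, y) + pd2 b (x, y)) := by linarith
  have hm : 0 ≤ m := (abs_nonneg _).trans (hdiv ((1/2 : ℝ), y) ⟨by norm_num [iq], hy⟩)
  rw [e, abs_neg, ← Real.norm_eq_abs]
  refine (intervalIntegral.norm_integral_le_of_norm_le_const (C := m) ?_).trans ?_
  · intro x hx
    rw [Set.uIoc_of_le (by norm_num)] at hx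
    refine (intervalIntegral.norm_integral_le_of_norm_le_const (C := m) ?_).trans ?_
    · intro s hs
      rw [Set.uIoc_of_le hy.2] at hs
      exact hdiv (x, s) ⟨⟨hx.1.le, hx.2⟩, ⟨hy.1.trans hs.1.le, hs.2⟩⟩
    · have : |1/2 - y| ≤ 1 := abs_le.2 ⟨by linarith [hy.2], by linarith [hy.1]⟩
      nlinarith
  · norm_num

/-- `L²`-type control of a field with bounded divergence and curl. -/
lemma rem_bd {a b : ℝ × ℝ → ℝ} (ha : ContDiff ℝ 2 a) (hb : ContDiff ℝ 2 b)
    (ha1 : ∀ y, a (1/2, y) = a (-(1/2), y)) (ha2 : ∀ x, a (x, 1/2) = a (x, -(1/2)))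
    (hb1 : ∀ y, b (1/2, y) = b (-(1/2), y)) (hb2 : ∀ x, b (x, 1/2) = b (x, -(1/2))) {m : ℝ}
    (hdiv : ∀ z ∈ qq, |pd1 a z + pd2 b z| ≤ m) (hcurl : ∀ z ∈ qq, |pd1 b z - pd2 a z| ≤ m)
    (h0 : ∫ x in iq, b (x, 1/2) = 0) :
    ∃ H : ℝ → ℝ, Continuous H ∧ (∀ z ∈ qq, b z ^ 2 ≤ 2 * m ^ 2 + 2 * H z.2) ∧
      ∫ y in iq, H y ≤ 2 * m ^ 2 := by
  have hb' := hb.of_le (m := 1) (by norm_num)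
  have ha' := ha.of_le (m := 1) (by norm_num)
  have hc := pd1_cont hb'
  refine ⟨fun y => ∫ s in iq, pd1 b (s, y) ^ 2, ?_, ?_, ?_⟩
  · simp_rw [int_iq]
    apply intervalIntegral.continuous_parametric_intervalIntegral_of_continuous' (by fun_prop)
  · rintro ⟨x, y⟩ ⟨hx, hy⟩
    exact poinc (f := fun x => b (x, y)) (fun x => pd1_has (hb.differentiable two_ne_zero) x y)
      (by fun_prop) (line_mean ha hb ha1 hdiv h0 hy) hx
  · rw [← int_qq' (f := fun z => pd1 b z ^ 2) (intOn_qq (by fun_prop))]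
    refine (div_curl ha hb ha1 ha2 hb1 hb2).trans ?_
    have h1 := pd2_cont hb'
    have h2 := pd1_cont ha'
    have h3 := pd2_cont ha'
    calc _ ≤ ∫ z in qq, (2 * m ^ 2) := by
          apply setIntegral_mono_on (intOn_qq (by fun_prop)) (intOn_qq (by fun_prop)) qq_meas
          intro z hz
          have a1 := sq_le_sq' (abs_le.1 (hdiv z hz)).1 (abs_le.1 (hdiv z hz)).2
          have a2 := sq_le_sq' (abs_le.1 (hcurl z hz)).1 (abs_le.1 (hcurl z hz)).2
          linarith
      _ = _ := by rw [setIntegral_const, vol_qq]; simp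

/-- The static core estimate. -/
lemma core {P : ℝ × ℝ → ℝ} (hP : ContDiff ℝ 2 P) (hP0 : ∀ z, 0 ≤ P z)
    (hsup : ∀ z, P z ≠ 0 → rad z < 1/2) (hi : ∫ z, P z = 1)
    {W h : ℝ → ℝ} {M : ℝ} (hM : 0 ≤ M) (hWb : ∀ s, |W s| ≤ M)
    (hc : Continuous h) (h0 : ∀ s, |h s| ≤ M) (h1 : ∀ c s, |h (c + s) - h c| ≤ M * |s|) (Γ : ℝ) :
    ∃ C : ℝ, 0 ≤ C ∧ ∀ (ε c : ℝ) (U1 U2 : ℝ × ℝ → ℝ), 0 < ε → ε ≤ 1/4 →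
      ContDiff ℝ 2 U1 → ContDiff ℝ 2 U2 →
      (∀ y, U1 (1/2, y) = U1 (-(1/2), y)) → (∀ x, U1 (x, 1/2) = U1 (x, -(1/2))) →
      (∀ y, U2 (1/2, y) = U2 (-(1/2), y)) → (∀ x, U2 (x, 1/2) = U2 (x, -(1/2))) →
      (∀ z ∈ qq, pd1 U1 z + pd2 U2 z = 0) →
      (∀ z ∈ qq, pd1 U2 z - pd2 U1 z = W (c + z.2) + Γ * (ε⁻¹ ^ 2 * P (ε⁻¹ • z))) →
      (∫ x in iq, U2 (x, 1/2) = 0) →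
      |(∫ z in qq, U2 z ^ 2 * h (c + z.2)) - Γ ^ 2 * (h c / (4 * π) * log (1 / ε))| ≤ C := by
  obtain ⟨V1, V2, A, hA, hV1, hV2, hdiv, hcurl, hb1, hb2, hfar⟩ := exists_V hP hP0 hsup hi
  obtain ⟨B, hB, hcb⟩ := cut_pd_bd
  obtain ⟨c0, c1, hc0, hc1, hcross⟩ := cross_term
  set m := M + |Γ| * (16 * A * B) with hm
  have hA0 : 0 ≤ A := by linarith
  have hm0 : 0 ≤ m := by positivity
  refine ⟨Γ ^ 2 * (M * (A ^ 2 + A + 10) * ((1 + π) * (2 * π))) +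
    2 * |Γ| * ((A * M) * c0 * (c1 + 2 * m ^ 2 + 2 * (2 * m ^ 2))) + M * (6 * m ^ 2),
    by positivity, ?_⟩
  intro ε c U1 U2 hε hε1 hU1 hU2 f1 f2 f3 f4 hd hcu hl
  have hmain := main_term hA hM hV2.continuous hb2 hfar hc h0 h1 hε hε1 c
  set K1 := sc V1 ε with hK1
  set K2 := sc V2 ε with hK2
  have cK1 : ContDiff ℝ 2 K1 := sc_cd hV1 ε
  have cK2 : ContDiff ℝ 2 K2 := sc_cd hV2 ε
  have bK1 : ∀ z, |K1 z| * rad z ≤ A := fun z => sc_bd hε (hb1 _)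
  have bK2 : ∀ z, |K2 z| * rad z ≤ A := fun z => sc_bd hε (hb2 _).2
  have dK : ∀ z, pd1 K1 z + pd2 K2 z = 0 := fun z => by
    simp only [pd1, pd2, hK1, hK2, sc_fd hV1, sc_fd hV2]
    have := hdiv (ε⁻¹ • z); simp only [pd1, pd2] at this
    rw [← mul_add, this, mul_zero]
  have uK : ∀ z, pd1 K2 z - pd2 K1 z = ε⁻¹ ^ 2 * P (ε⁻¹ • z) := fun z => by
    simp only [pd1, pd2, hK1, hK2, sc_fd hV1, sc_fd hV2]
    have := hcurl (ε⁻¹ • z); simp only [pd1, pd2] at this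
    rw [← mul_sub, this]
  set k1 : ℝ × ℝ → ℝ := fun z => cut z * K1 z with hk1
  set k2 : ℝ × ℝ → ℝ := fun z => cut z * K2 z with hk2
  have ck1 : ContDiff ℝ 2 k1 := cut_cd.mul cK1
  have ck2 : ContDiff ℝ 2 k2 := cut_cd.mul cK2
  have dcut := cut_cd.differentiable two_ne_zero
  have dK1 := cK1.differentiable two_ne_zero
  have dK2 := cK2.differentiable two_ne_zero
  have dU1 := hU1.differentiable two_ne_zero
  have dU2 := hU2.differentiable two_ne_zero
  set a : ℝ × ℝ → ℝ := fun z => U1 z - Γ * k1 z with ha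
  set b : ℝ × ℝ → ℝ := fun z => U2 z - Γ * k2 z with hb
  have ca : ContDiff ℝ 2 a := hU1.sub (contDiff_const.mul ck1)
  have cb : ContDiff ℝ 2 b := hU2.sub (contDiff_const.mul ck2)
  have pdc1 : ∀ (c : ℝ) (z : ℝ × ℝ), pd1 (fun _ => c) z = 0 := fun c z => by simp [pd1]
  have pdc2 : ∀ (c : ℝ) (z : ℝ × ℝ), pd2 (fun _ => c) z = 0 := fun c z => by simp [pd2]
  have dk1 := ck1.differentiable two_ne_zero
  have dk2 := ck2.differentiable two_ne_zero
  have p1a : ∀ z, pd1 a z = pd1 U1 z - Γ * (pd1 cut z * K1 z + cut z * pd1 K1 z) := fun z => by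
    rw [ha, pd1_sub (dU1 z) ((differentiableAt_const Γ).fun_mul (dk1 z)),
      pd1_mul (differentiableAt_const Γ) (dk1 z), hk1, pd1_mul (dcut z) (dK1 z), pdc1]; ring
  have p2a : ∀ z, pd2 a z = pd2 U1 z - Γ * (pd2 cut z * K1 z + cut z * pd2 K1 z) := fun z => by
    rw [ha, pd2_sub (dU1 z) ((differentiableAt_const Γ).fun_mul (dk1 z)),
      pd2_mul (differentiableAt_const Γ) (dk1 z), hk1, pd2_mul (dcut z) (dK1 z), pdc2]; ring
  have p1b : ∀ z, pd1 b z = pd1 U2 z - Γ * (pd1 cut z * K2 z + cut z * pd1 K2 z) := fun z => by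
    rw [hb, pd1_sub (dU2 z) ((differentiableAt_const Γ).fun_mul (dk2 z)),
      pd1_mul (differentiableAt_const Γ) (dk2 z), hk2, pd1_mul (dcut z) (dK2 z), pdc1]; ring
  have p2b : ∀ z, pd2 b z = pd2 U2 z - Γ * (pd2 cut z * K2 z + cut z * pd2 K2 z) := fun z => by
    rw [hb, pd2_sub (dU2 z) ((differentiableAt_const Γ).fun_mul (dk2 z)),
      pd2_mul (differentiableAt_const Γ) (dk2 z), hk2, pd2_mul (dcut z) (dK2 z), pdc2]; ring
  have hdv : ∀ z ∈ qq, |pd1 a z + pd2 b z| ≤ m := by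
    intro z hz
    have e : pd1 a z + pd2 b z = -(Γ * (pd1 cut z * K1 z + pd2 cut z * K2 z)) := by
      rw [p1a, p2b]; linear_combination hd z hz - Γ * cut z * dK z
    have q1 := cut_prod_bd hA0 hB bK1 (hcb z hz).1 (fun h => (cut_pd_zero h).1)
    have q2 := cut_prod_bd hA0 hB bK2 (hcb z hz).2 (fun h => (cut_pd_zero h).2)
    rw [e, abs_neg, abs_mul]
    have := abs_add_le (pd1 cut z * K1 z) (pd2 cut z * K2 z)
    have : |Γ| * |pd1 cut z * K1 z + pd2 cut z * K2 z| ≤ |Γ| * (16 * A * B) := by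
      gcongr; linarith
    linarith
  have hcv : ∀ z ∈ qq, |pd1 b z - pd2 a z| ≤ m := by
    intro z hz
    have hcp : cut z * P (ε⁻¹ • z) = P (ε⁻¹ • z) := by
      by_cases hp : P (ε⁻¹ • z) = 0
      · rw [hp, mul_zero]
      · have := hsup _ hp
        rw [rad_smul (by positivity), inv_mul_eq_div, div_lt_iff₀ hε] at this
        rw [cut_one (by linarith), one_mul]
    have e : pd1 b z - pd2 a z = W (c + z.2) - Γ * (pd1 cut z * K2 z - pd2 cut z * K1 z) := by
      rw [p1b, p2a]
      linear_combination hcu z hz - Γ * cut z * uK z - Γ * ε⁻¹ ^ 2 * hcp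
    have q1 := cut_prod_bd hA0 hB bK2 (hcb z hz).1 (fun h => (cut_pd_zero h).1)
    have q2 := cut_prod_bd hA0 hB bK1 (hcb z hz).2 (fun h => (cut_pd_zero h).2)
    rw [e]
    have t1 := abs_sub (W (c + z.2)) (Γ * (pd1 cut z * K2 z - pd2 cut z * K1 z))
    rw [abs_mul] at t1
    have := abs_sub (pd1 cut z * K2 z) (pd2 cut z * K1 z)
    have : |Γ| * |pd1 cut z * K2 z - pd2 cut z * K1 z| ≤ |Γ| * (16 * A * B) := by
      gcongr; linarith
    linarith [hWb (c + z.2)]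
  obtain ⟨H, Hc, Hb, Hi⟩ := rem_bd ca cb
    (fun y => by simp only [ha, hk1, face_cut1 y, f1, zero_mul]) (fun x => by simp only [ha, hk1, face_cut2 x, f2, zero_mul])
    (fun y => by simp only [hb, hk2, face_cut1 y, f3, zero_mul]) (fun x => by simp only [hb, hk2, face_cut2 x, f4, zero_mul])
    hdv hcv (by simp only [hb, hk2, face_cut2]; simpa using hl)
  have hcut := cut_cd.continuous
  have hK2c := cK2.continuous
  have hbc := cb.continuous
  have hk2c := ck2.continuous
  have hT := hcross (fun z => k2 z * h (c + z.2)) b H (A * M) m (2 * m ^ 2) (by fun_prop) hbc Hc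
    (by positivity) (fun z => by
      have := cut_nonneg z
      have := cut_le_one z
      rw [hk2, abs_mul, abs_mul, abs_of_nonneg (cut_nonneg z)]
      calc cut z * |K2 z| * |h (c + z.2)| * rad z = cut z * (|K2 z| * rad z) * |h (c + z.2)| := by ring
        _ ≤ 1 * A * M := by
          gcongr
          · have := rad_nonneg z; positivity
          · exact bK2 z
          · exact h0 _
        _ = A * M := by ring) Hb Hi
  have i1 : IntegrableOn (fun z => Γ ^ 2 * (k2 z ^ 2 * h (c + z.2))) qq := intOn_qq (by fun_prop)
  have i2 : IntegrableOn (fun z => 2 * Γ * (k2 z * h (c + z.2) * b z)) qq := intOn_qq (by fun_prop)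
  have i3 : IntegrableOn (fun z => b z ^ 2 * h (c + z.2)) qq := intOn_qq (by fun_prop)
  have i12 : IntegrableOn (fun z => Γ ^ 2 * (k2 z ^ 2 * h (c + z.2))
      + 2 * Γ * (k2 z * h (c + z.2) * b z)) qq := intOn_qq (by fun_prop)
  have hsum : ∫ z in qq, U2 z ^ 2 * h (c + z.2) = Γ ^ 2 * (∫ z in qq, k2 z ^ 2 * h (c + z.2))
      + 2 * Γ * (∫ z in qq, k2 z * h (c + z.2) * b z) + ∫ z in qq, b z ^ 2 * h (c + z.2) := by
    rw [← integral_const_mul, ← integral_const_mul, ← integral_add i1 i2, ← integral_add i12 i3]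
    congr 1; ext z
    simp only [hb]; ring
  have hR : |∫ z in qq, b z ^ 2 * h (c + z.2)| ≤ M * (6 * m ^ 2) := by
    have ih : IntegrableOn (fun z : ℝ × ℝ => 2 * m ^ 2 + 2 * H z.2) qq := intOn_qq (by fun_prop)
    have := norm_integral_le_of_norm_le (f := fun z => b z ^ 2 * h (c + z.2)) (ih.const_mul M)
      ((ae_restrict_iff' qq_meas).2 (Filter.Eventually.of_forall fun z hz => by
        rw [norm_mul, Real.norm_eq_abs, Real.norm_eq_abs, abs_of_nonneg (sq_nonneg _), mul_comm]
        exact mul_le_mul (h0 _) (Hb z hz) (sq_nonneg _) hM))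
    rw [Real.norm_eq_abs] at this
    refine this.trans ?_
    rw [integral_const_mul, int_qq' ih]
    gcongr
    have ic : IntegrableOn (fun _ : ℝ => 2 * m ^ 2) iq :=
      continuous_const.continuousOn.integrableOn_compact iq_compact
    have iH : IntegrableOn H iq := Hc.continuousOn.integrableOn_compact iq_compact
    simp only [setIntegral_const, vol_iq, one_smul]
    rw [integral_add ic (iH.const_mul 2), integral_const_mul 2 H, setIntegral_const, vol_iq, one_smul]
    linarith
  rw [hsum]
  set X1 := ∫ z in qq, k2 z ^ 2 * h (c + z.2)
  set X2 := ∫ z in qq, k2 z * h (c + z.2) * b z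
  set X3 := ∫ z in qq, b z ^ 2 * h (c + z.2)
  set L := h c / (4 * π) * log (1 / ε)
  have e : Γ ^ 2 * X1 + 2 * Γ * X2 + X3 - Γ ^ 2 * L = Γ ^ 2 * (X1 - L) + 2 * Γ * X2 + X3 := by ring
  rw [e]
  refine (abs_add_three _ _ _).trans ?_
  rw [abs_mul, abs_mul, abs_mul 2 Γ, abs_of_nonneg (sq_nonneg Γ), abs_two]
  gcongr


/-- Time derivative. -/
def dtt (F : ℝ × (ℝ × ℝ) → ℝ) (q : ℝ × (ℝ × ℝ)) : ℝ := fderiv ℝ F q (1, 0)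

lemma dtt_cont {F : ℝ × (ℝ × ℝ) → ℝ} (hF : ContDiff ℝ 1 F) : Continuous (dtt F) :=
  (hF.continuous_fderiv one_ne_zero).clm_apply continuous_const

lemma dtt_cd {F : ℝ × (ℝ × ℝ) → ℝ} (hF : ContDiff ℝ 2 F) : ContDiff ℝ 1 (dtt F) :=
  (hF.fderiv_right (m := 1) (by norm_num)).clm_apply contDiff_const

lemma dtt_has {F : ℝ × (ℝ × ℝ) → ℝ} (hF : Differentiable ℝ F) (t : ℝ) (z : ℝ × ℝ) :
    HasDerivAt (fun s => F (s, z)) (dtt F (t, z)) t := by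
  have h : HasDerivAt (fun s : ℝ => ((s, z) : ℝ × (ℝ × ℝ))) (1, 0) t :=
    (hasDerivAt_id t).prodMk (hasDerivAt_const t z)
  exact (hF (t, z)).hasFDerivAt.comp_hasDerivAt t h

lemma slice_cd {F : ℝ × (ℝ × ℝ) → ℝ} {n : WithTop ℕ∞} (hF : ContDiff ℝ n F) (t : ℝ) :
    ContDiff ℝ n (fun z => F (t, z)) := hF.comp (contDiff_const.prodMk contDiff_id)

/-- Differentiation under the integral sign. -/
lemma int_has {F : ℝ × (ℝ × ℝ) → ℝ} (hF : ContDiff ℝ 1 F) (t : ℝ) :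
    HasDerivAt (fun s => ∫ z in qq, F (s, z)) (∫ z in qq, dtt F (t, z)) t := by
  have hd := dtt_cont hF
  obtain ⟨B, hB⟩ := ((isCompact_closedBall t 1).prod qq_compact).exists_bound_of_continuousOn
    hd.continuousOn
  have hc := hF.continuous
  refine (hasDerivAt_integral_of_dominated_loc_of_deriv_le (μ := volume.restrict qq)
    (F := fun s z => F (s, z)) (F' := fun s z => dtt F (s, z)) (bound := fun _ => B)
    (s := Metric.closedBall t 1) (Metric.closedBall_mem_nhds t one_pos) ?_ ?_ ?_ ?_ ?_ ?_).2
  · exact Filter.Eventually.of_forall fun s => (by fun_prop : Continuous fun z => F (s, z)).aestronglyMeasurable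
  · exact intOn_qq (by fun_prop)
  · exact (by fun_prop : Continuous fun z => dtt F (t, z)).aestronglyMeasurable
  · rw [ae_restrict_iff' qq_meas]
    exact Filter.Eventually.of_forall fun z hz s hs => hB (s, z) ⟨hs, hz⟩
  · exact intOn_qq continuous_const
  · exact Filter.Eventually.of_forall fun z s _ => dtt_has (hF.differentiable one_ne_zero) s z

/-- `∫ u₂ curl u = 0`. -/
lemma u2_curl {a b : ℝ × ℝ → ℝ} (ha : ContDiff ℝ 2 a) (hb : ContDiff ℝ 2 b)
    (ha1 : ∀ y, a (1/2, y) = a (-(1/2), y)) (ha2 : ∀ x, a (x, 1/2) = a (x, -(1/2)))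
    (hb1 : ∀ y, b (1/2, y) = b (-(1/2), y)) (hb2 : ∀ x, b (x, 1/2) = b (x, -(1/2)))
    (hd : ∀ z, pd1 a z + pd2 b z = 0) :
    ∫ z in qq, b z * (pd1 b z - pd2 a z) = 0 := by
  have ha' := ha.of_le (m := 1) (by norm_num)
  have hb' := hb.of_le (m := 1) (by norm_num)
  have da := ha.differentiable two_ne_zero
  have db := hb.differentiable two_ne_zero
  have h := div_qq (f := fun z => b z * b z - a z * a z) (g := fun z => (-2 * a z) * b z)
    ((hb'.mul hb').sub (ha'.mul ha')) ((contDiff_const.mul ha').mul hb')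
    (fun y _ => by simp only [ha1, hb1]) (fun x _ => by simp only [ha2, hb2])
  have e : ∀ z, pd1 (fun z => b z * b z - a z * a z) z + pd2 (fun z => (-2 * a z) * b z) z
      = 2 * (b z * (pd1 b z - pd2 a z)) := by
    intro z
    rw [pd1_sub ((db z).fun_mul (db z)) ((da z).fun_mul (da z)), pd1_mul (db z) (db z),
      pd1_mul (da z) (da z), pd2_mul ((differentiableAt_const _).fun_mul (da z)) (db z),
      pd2_mul (differentiableAt_const _) (da z)]
    have : pd2 (fun _ : ℝ × ℝ => (-2 : ℝ)) z = 0 := by simp [pd2]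
    rw [this]
    linear_combination (-2 * a z) * hd z
  simp_rw [e] at h
  rw [integral_const_mul] at h
  linarith

/-- `∫ u₂ g(y) = 0` when line means vanish. -/
lemma line_zero {b : ℝ × ℝ → ℝ} {g : ℝ → ℝ} (hb : Continuous b) (hg : Continuous g)
    (hl : ∀ y, ∫ x in iq, b (x, y) = 0) : ∫ z in qq, b z * g z.2 = 0 := by
  rw [int_qq' (intOn_qq (by fun_prop))]
  simp [integral_mul_const, hl]

lemma mono_of {G G' : ℝ → ℝ} {d T : ℝ} (hG : ∀ t, HasDerivAt G (G' t) t) (h0 : G' 0 = 0)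
    (h1 : HasDerivAt G' d 0) (hd : 0 < d) (hT : 0 < T) :
    ∃ T' : ℝ, 0 < T' ∧ T' ≤ T ∧ StrictMonoOn G (Set.Icc 0 T') := by
  have h := (hasDerivAt_iff_tendsto_slope.1 h1).eventually (lt_mem_nhds hd)
  rw [eventually_nhdsWithin_iff, Metric.eventually_nhds_iff] at h
  obtain ⟨δ, hδ, h⟩ := h
  refine ⟨min T (δ/2), by positivity, min_le_left _ _, ?_⟩
  apply strictMonoOn_of_deriv_pos (convex_Icc _ _)
  · exact fun t _ => (hG t).continuousAt.continuousWithinAt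
  · intro t ht
    rw [interior_Icc] at ht
    have h2 : t < δ / 2 := ht.2.trans_le (min_le_right _ _)
    have := h (y := t) (by rw [dist_zero_right, Real.norm_eq_abs, abs_of_pos ht.1]; linarith)
      (ne_of_gt ht.1)
    rw [slope_def_field, h0, sub_zero, sub_zero] at this
    rw [(hG t).deriv]
    exact (div_pos_iff_of_pos_right ht.1).1 this

/-- The dynamic part, in coordinates. -/
lemma dyn {T c : ℝ} (hT : 0 < T) {w : ℝ → ℝ} (hw : ContDiff ℝ 2 w) {R O U1 U2 : ℝ × (ℝ × ℝ) → ℝ}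
    (hR : ContDiff ℝ 2 R) (hO : ContDiff ℝ 2 O) (hU1 : ContDiff ℝ 2 U1) (hU2 : ContDiff ℝ 2 U2)
    (r1 : ∀ t y, R (t, 1/2, y) = R (t, -(1/2), y))
    (f1 : ∀ t y, U1 (t, 1/2, y) = U1 (t, -(1/2), y)) (f2 : ∀ t x, U1 (t, x, 1/2) = U1 (t, x, -(1/2)))
    (f3 : ∀ t y, U2 (t, 1/2, y) = U2 (t, -(1/2), y)) (f4 : ∀ t x, U2 (t, x, 1/2) = U2 (t, x, -(1/2)))
    (hdiv : ∀ t ∈ Set.Icc 0 T, ∀ z, pd1 (fun z => U1 (t, z)) z + pd2 (fun z => U2 (t, z)) z = 0)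
    (hcurl : ∀ t ∈ Set.Icc 0 T, ∀ z,
      pd1 (fun z => U2 (t, z)) z - pd2 (fun z => U1 (t, z)) z = O (t, z) + R (t, z))
    (trR : ∀ t ∈ Set.Icc 0 T, ∀ z, dtt R (t, z) + (U1 (t, z) * pd1 (fun z => R (t, z)) z
      + U2 (t, z) * pd2 (fun z => R (t, z)) z) = 0)
    (trO : ∀ t ∈ Set.Icc 0 T, ∀ z, dtt O (t, z) + (U1 (t, z) * pd1 (fun z => O (t, z)) z
      + U2 (t, z) * pd2 (fun z => O (t, z)) z) = 0)
    (hO0 : ∀ z, O (0, z) = w (c + z.2))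
    (hl : ∀ t ∈ Set.Icc 0 T, ∀ y, ∫ x in iq, U2 (t, x, y) = 0)
    (hs : ∀ t ∈ Set.Icc 0 T, ∀ x ∈ iq, R (t, x, 1/2) = 0 ∧ R (t, x, -(1/2)) = 0) :
    ∃ G' : ℝ → ℝ, (∀ t, HasDerivAt (fun t => ∫ z in qq, R (t, z) * z.2) (G' t) t) ∧
      G' 0 = 0 ∧ HasDerivAt G' (∫ z in qq, U2 (0, z) ^ 2 * deriv w (c + z.2)) 0 := by
  set F : ℝ × (ℝ × ℝ) → ℝ := fun q => R q * q.2.2 with hF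
  have cF : ContDiff ℝ 2 F := hR.mul (by fun_prop)
  have cF1 := cF.of_le (m := 1) (by norm_num)
  set E : ℝ × (ℝ × ℝ) → ℝ := fun q => -(U2 q * (O q - w (c + q.2.2))) with hE
  have cw : ContDiff ℝ 2 (fun q : ℝ × (ℝ × ℝ) => w (c + q.2.2)) := hw.comp (by fun_prop)
  have cE : ContDiff ℝ 2 E := (hU2.mul (hO.sub cw)).neg
  have cE1 := cE.of_le (m := 1) (by norm_num)
  have key : ∀ t ∈ Set.Icc 0 T, ∫ z in qq, dtt F (t, z) = ∫ z in qq, E (t, z) := by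
    intro t ht
    have sR := (slice_cd hR t).of_le (m := 1) (by norm_num)
    have sO := (slice_cd hO t).of_le (m := 1) (by norm_num)
    have s1 := slice_cd hU1 t
    have s2 := slice_cd hU2 t
    have s1' := s1.of_le (m := 1) (by norm_num)
    have s2' := s2.of_le (m := 1) (by norm_num)
    have dR := sR.differentiable one_ne_zero
    have d1 := s1'.differentiable one_ne_zero
    have d2 := s2'.differentiable one_ne_zero
    have dy : Differentiable ℝ (fun z : ℝ × ℝ => z.2) := by fun_prop
    have p1y : ∀ z, pd1 (fun z : ℝ × ℝ => z.2) z = 0 := fun z => by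
      simp [pd1, show (fun z : ℝ × ℝ => z.2) = Prod.snd from rfl, fderiv_snd]
    have p2y : ∀ z, pd2 (fun z : ℝ × ℝ => z.2) z = 1 := fun z => by
      simp [pd2, show (fun z : ℝ × ℝ => z.2) = Prod.snd from rfl, fderiv_snd]
    have e1 : ∀ z, dtt F (t, z) = dtt R (t, z) * z.2 := fun z =>
      (dtt_has (cF1.differentiable one_ne_zero) t z).unique
        ((dtt_has (hR.differentiable two_ne_zero) t z).mul_const z.2)
    have h1 := div_qq (f := fun z => U1 (t, z) * R (t, z) * z.2)
      (g := fun z => U2 (t, z) * R (t, z) * z.2)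
      ((s1'.mul sR).mul (by fun_prop)) ((s2'.mul sR).mul (by fun_prop))
      (fun y _ => by simp only [r1, f1]) (fun x hx => by simp only [hs t ht x hx, mul_zero, zero_mul])
    have e2 : ∀ z, pd1 (fun z => U1 (t, z) * R (t, z) * z.2) z
        + pd2 (fun z => U2 (t, z) * R (t, z) * z.2) z
        = -dtt F (t, z) + U2 (t, z) * R (t, z) := by
      intro z
      rw [pd1_mul ((d1 z).fun_mul (dR z)) (dy z), pd1_mul (d1 z) (dR z),
        pd2_mul ((d2 z).fun_mul (dR z)) (dy z), pd2_mul (d2 z) (dR z), p1y, p2y, e1]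
      linear_combination (R (t, z) * z.2) * hdiv t ht z + z.2 * trR t ht z
    have cdF := dtt_cont cF1
    have cR := hR.continuous
    have cO := hO.continuous
    have c2 := hU2.continuous
    have cwc := hw.continuous
    simp_rw [e2] at h1
    have h1' : (∫ z in qq, -dtt F (t, z)) + ∫ z in qq, U2 (t, z) * R (t, z) = 0 := by
      rw [← integral_add (intOn_qq (by fun_prop)) (intOn_qq (by fun_prop))]; exact h1
    rw [integral_neg] at h1'
    have h2 := u2_curl s1 s2 (f1 t) (f2 t) (f3 t) (f4 t) (hdiv t ht)
    simp_rw [hcurl t ht] at h2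
    have h3 := line_zero (b := fun z => U2 (t, z)) (g := fun y => w (c + y)) (by fun_prop)
      (by fun_prop) (hl t ht)
    have h4 : ∫ z in qq, E (t, z) = (∫ z in qq, U2 (t, z) * R (t, z))
        - (∫ z in qq, U2 (t, z) * (O (t, z) + R (t, z))) + ∫ z in qq, U2 (t, z) * w (c + z.2) := by
      have j1 : IntegrableOn (fun z => U2 (t, z) * R (t, z)) qq := intOn_qq (by fun_prop)
      have j2 : IntegrableOn (fun z => U2 (t, z) * (O (t, z) + R (t, z))) qq := intOn_qq (by fun_prop)
      have j3 : IntegrableOn (fun z => U2 (t, z) * w (c + z.2)) qq := intOn_qq (by fun_prop)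
      have j4 : IntegrableOn (fun z => U2 (t, z) * R (t, z) - U2 (t, z) * (O (t, z) + R (t, z))) qq :=
        intOn_qq (by fun_prop)
      rw [← integral_sub j1 j2, ← integral_add j4 j3]
      congr 1; ext z; simp only [hE]; ring
    linarith
  have hE0 : ∀ z, E (0, z) = 0 := fun z => by simp [hE, hO0]
  have h0T : (0:ℝ) ∈ Set.Icc 0 T := ⟨le_rfl, hT.le⟩
  refine ⟨fun t => ∫ z in qq, dtt F (t, z), fun t => int_has cF1 t, ?_, ?_⟩
  · simp only [key 0 h0T, hE0]; simp
  · have g1 := int_has (dtt_cd cF) 0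
    have g2 := int_has cE1 0
    have e : ∀ z, dtt E (0, z) = U2 (0, z) ^ 2 * deriv w (c + z.2) := by
      intro z
      have a1 := dtt_has (hU2.differentiable two_ne_zero) 0 z
      have a2 := (dtt_has (hO.differentiable two_ne_zero) 0 z).sub_const (w (c + z.2))
      have a3 := (a1.mul a2).neg
      have a4 := (dtt_has (cE1.differentiable one_ne_zero) 0 z).unique a3
      have hwd := hw.differentiable two_ne_zero
      have b1 : pd1 (fun z => O (0, z)) z = 0 := by
        have := pd1_has ((slice_cd hO 0).differentiable two_ne_zero) z.1 z.2
        simp only [hO0] at this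
        have h := this.unique (hasDerivAt_const _ _)
        simp only [hO0]; exact h
      have b2 : pd2 (fun z => O (0, z)) z = deriv w (c + z.2) := by
        have := pd2_has ((slice_cd hO 0).differentiable two_ne_zero) z.1 z.2
        simp only [hO0] at this
        have h := this.unique ((hwd (c + z.2)).hasDerivAt.comp_const_add c z.2)
        simp only [hO0]; exact h
      have b3 := trO 0 h0T z
      rw [b1, b2] at b3
      rw [a4, hO0]
      linear_combination (-U2 (0, z)) * b3
    simp_rw [e] at g2
    have hu := (uniqueDiffOn_Icc hT 0 h0T).eq_deriv _ g1.hasDerivWithinAt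
      (g2.hasDerivWithinAt.congr (fun t ht => key t ht) (key 0 h0T))
    rw [← hu]
    exact g1


/-- Coordinates on the plane. -/
def JL : ℝ × ℝ →L[ℝ] EuclideanSpace ℝ (Fin 2) :=
  (ContinuousLinearMap.fst ℝ ℝ ℝ).smulRight (e2 0) + (ContinuousLinearMap.snd ℝ ℝ ℝ).smulRight (e2 1)

lemma JL_apply (z : ℝ × ℝ) : JL z = z.1 • e2 0 + z.2 • e2 1 := rfl

lemma JL_0 (z : ℝ × ℝ) : JL z 0 = z.1 := by simp [JL_apply, e2]

lemma JL_1 (z : ℝ × ℝ) : JL z 1 = z.2 := by simp [JL_apply, e2]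

lemma JL_e1 : JL (1, 0) = e2 0 := by simp [JL_apply]

lemma JL_e2 : JL (0, 1) = e2 1 := by simp [JL_apply]

lemma vec_split (v : EuclideanSpace ℝ (Fin 2)) : v = v 0 • e2 0 + v 1 • e2 1 := by
  ext i; fin_cases i <;> simp [e2]

lemma JL_norm (z : ℝ × ℝ) : ‖JL z‖ = rad z := by
  rw [EuclideanSpace.norm_eq, Fin.sum_univ_two, JL_0, JL_1, rad]; simp

lemma JL_sq2 (z : ℝ × ℝ) : JL z ∈ sq2 ↔ z ∈ qq := by
  simp only [sq2, Set.mem_setOf_eq, Fin.forall_fin_two, JL_0, JL_1, qq, iq, Set.mem_prod]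

lemma JL_mp : MeasurePreserving JL volume volume ∧ MeasurableEmbedding JL := by
  set e := (MeasurableEquiv.finTwoArrow (α := ℝ)).symm.trans (MeasurableEquiv.toLp 2 (Fin 2 → ℝ))
  have h : (JL : ℝ × ℝ → EuclideanSpace ℝ (Fin 2)) = e := by
    funext z; ext i
    fin_cases i
    · exact JL_0 z
    · exact JL_1 z
  rw [h]
  refine ⟨?_, e.measurableEmbedding⟩
  exact (PiLp.volume_preserving_toLp (Fin 2)).comp
    ((volume_preserving_finTwoArrow ℝ).symm (MeasurableEquiv.finTwoArrow))

lemma int_sq2 {E : Type*} [NormedAddCommGroup E] [NormedSpace ℝ E]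
    (f : EuclideanSpace ℝ (Fin 2) → E) : ∫ y in sq2, f y = ∫ z in qq, f (JL z) := by
  rw [← JL_mp.1.setIntegral_preimage_emb JL_mp.2]
  congr 2
  ext z; exact JL_sq2 z

lemma int_all (f : EuclideanSpace ℝ (Fin 2) → ℝ) : ∫ y, f y = ∫ z, f (JL z) :=
  (JL_mp.1.integral_comp JL_mp.2 f).symm

lemma fd_JL {f : EuclideanSpace ℝ (Fin 2) → ℝ} (hf : Differentiable ℝ f)
    (x0 : EuclideanSpace ℝ (Fin 2)) (z v : ℝ × ℝ) :
    fderiv ℝ (fun z => f (x0 + JL z)) z v = fderiv ℝ f (x0 + JL z) (JL v) := by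
  have h1 : HasFDerivAt (fun z => x0 + JL z) JL z := (JL.hasFDerivAt).const_add x0
  have h2 := (hf (x0 + JL z)).hasFDerivAt.comp z h1
  have h3 : HasFDerivAt (fun z => f (x0 + JL z)) _ z := h2
  rw [h3.fderiv]; rfl

lemma pd1_JL {f : EuclideanSpace ℝ (Fin 2) → ℝ} (hf : Differentiable ℝ f)
    (x0 : EuclideanSpace ℝ (Fin 2)) (z : ℝ × ℝ) :
    pd1 (fun z => f (x0 + JL z)) z = fderiv ℝ f (x0 + JL z) (e2 0) := by
  rw [pd1, fd_JL hf, JL_e1]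

lemma pd2_JL {f : EuclideanSpace ℝ (Fin 2) → ℝ} (hf : Differentiable ℝ f)
    (x0 : EuclideanSpace ℝ (Fin 2)) (z : ℝ × ℝ) :
    pd2 (fun z => f (x0 + JL z)) z = fderiv ℝ f (x0 + JL z) (e2 1) := by
  rw [pd2, fd_JL hf, JL_e2]

lemma per1 {β : Type*} {f : EuclideanSpace ℝ (Fin 2) → β} (hf : ∀ x k, f (x + zvec2 k) = f x)
    (x0 : EuclideanSpace ℝ (Fin 2)) (x y : ℝ) : f (x0 + JL (x + 1, y)) = f (x0 + JL (x, y)) := by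
  rw [← hf (x0 + JL (x, y)) ![1, 0]]
  congr 1
  ext i; fin_cases i <;> simp [JL_0, JL_1, zvec2, add_assoc]

lemma per2 {β : Type*} {f : EuclideanSpace ℝ (Fin 2) → β} (hf : ∀ x k, f (x + zvec2 k) = f x)
    (x0 : EuclideanSpace ℝ (Fin 2)) (x y : ℝ) : f (x0 + JL (x, y + 1)) = f (x0 + JL (x, y)) := by
  rw [← hf (x0 + JL (x, y)) ![0, 1]]
  congr 1
  ext i; fin_cases i <;> simp [JL_0, JL_1, zvec2, add_assoc]

lemma per1h {β : Type*} {f : EuclideanSpace ℝ (Fin 2) → β} (hf : ∀ x k, f (x + zvec2 k) = f x)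
    (x0 : EuclideanSpace ℝ (Fin 2)) (y : ℝ) : f (x0 + JL (1/2, y)) = f (x0 + JL (-(1/2), y)) := by
  rw [← per1 hf x0 (-(1/2)) y]; norm_num

lemma per2h {β : Type*} {f : EuclideanSpace ℝ (Fin 2) → β} (hf : ∀ x k, f (x + zvec2 k) = f x)
    (x0 : EuclideanSpace ℝ (Fin 2)) (x : ℝ) : f (x0 + JL (x, 1/2)) = f (x0 + JL (x, -(1/2))) := by
  rw [← per2 hf x0 x (-(1/2))]; norm_num

/-- Line means of the second velocity component vanish. -/
lemma line_u {v : EuclideanSpace ℝ (Fin 2) → EuclideanSpace ℝ (Fin 2)} (hv : ContDiff ℝ 2 v)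
    (hp : ∀ x k, v (x + zvec2 k) = v x)
    (hd : ∀ x, fderiv ℝ (fun y => v y 0) x (e2 0) + fderiv ℝ (fun y => v y 1) x (e2 1) = 0)
    (hm : ∫ x in sq2, v x = 0) (x0 : EuclideanSpace ℝ (Fin 2)) (y : ℝ) :
    ∫ x in iq, v (x0 + JL (x, y)) 1 = 0 := by
  have c0 : ContDiff ℝ 2 (fun y => v y 0) := (contDiff_euclidean.1 hv) 0
  have c1 : ContDiff ℝ 2 (fun y => v y 1) := (contDiff_euclidean.1 hv) 1
  have d0 := c0.differentiable two_ne_zero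
  have d1 := c1.differentiable two_ne_zero
  set a : ℝ × ℝ → ℝ := fun z => v (0 + JL z) 0 with ha
  set b : ℝ × ℝ → ℝ := fun z => v (0 + JL z) 1 with hb
  have cJ : ContDiff ℝ 2 (fun z => (0 : EuclideanSpace ℝ (Fin 2)) + JL z) := by fun_prop
  have ca : ContDiff ℝ 1 a := (c0.comp cJ).of_le (by norm_num)
  have cb : ContDiff ℝ 1 b := (c1.comp cJ).of_le (by norm_num)
  have hdz : ∀ z, pd1 a z + pd2 b z = 0 := fun z => by
    rw [ha, hb, pd1_JL d0, pd2_JL d1]; exact hd _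
  have hN : ∀ y y', ∫ x in iq, b (x, y) = ∫ x in iq, b (x, y') := by
    intro y y'
    have h := div_rect ca cb (-(1/2)) (1/2) y' y
    simp_rw [hdz] at h
    have e : ∀ s, a (1/2, s) = a (-(1/2), s) := fun s => by
      simp only [ha]; rw [per1h hp 0 s]
    simp_rw [e] at h
    rw [int_iq, int_iq]
    simp at h
    linarith
  have hz : ∫ z in qq, b z = 0 := by
    have cint : IntegrableOn (fun z => v (JL z)) qq :=
      ((hv.continuous.comp JL.continuous).continuousOn.integrableOn_compact qq_compact)
    rw [int_sq2] at hm
    have := (EuclideanSpace.proj (𝕜 := ℝ) (1 : Fin 2)).integral_comp_comm cint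
    rw [hm] at this
    simp at this
    simpa [hb] using this
  have hN0 : ∀ y, ∫ x in iq, b (x, y) = 0 := by
    intro y
    rw [int_qq' (intOn_qq cb.continuous)] at hz
    simp_rw [fun y' => hN y' y] at hz
    rw [setIntegral_const, vol_iq, one_smul] at hz
    exact hz
  have hper : Function.Periodic (fun x => b (x, x0 1 + y)) 1 := fun x => by
    simp only [hb]; rw [per1 hp 0 x]
  have e : ∀ x, v (x0 + JL (x, y)) 1 = b (x + x0 0, x0 1 + y) := fun x => by
    have h3 : x0 + JL (x, y) = 0 + JL (x + x0 0, x0 1 + y) := by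
      ext i; fin_cases i <;> simp [JL_0, JL_1, add_comm]
    simp only [hb]
    rw [h3]
  simp_rw [e]
  rw [int_iq, intervalIntegral.integral_comp_add_right (fun x => b (x, x0 1 + y))]
  have h1 := hper.intervalIntegral_add_eq (-(1/2) + x0 0) (-(1/2))
  have h2 := hN0 (x0 1 + y)
  rw [int_iq] at h2
  rw [show (1/2 : ℝ) + x0 0 = -(1/2) + x0 0 + 1 by ring, h1, ← h2]
  norm_num

/-- The circulation is determined by the shear. -/
lemma gam {P : ℝ × ℝ → ℝ} (hP : Continuous P)
    (hsup : ∀ z, P z ≠ 0 → rad z < 1/2) (hi : ∫ z, P z = 1) {w : ℝ → ℝ} (hw : Continuous w)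
    (hwp : Function.Periodic w 1) {ε c Γ : ℝ} (hε : 0 < ε) (hε1 : ε ≤ 1/4) {U1 U2 : ℝ × ℝ → ℝ}
    (hU1 : ContDiff ℝ 2 U1) (hU2 : ContDiff ℝ 2 U2)
    (f2 : ∀ x, U1 (x, 1/2) = U1 (x, -(1/2))) (f3 : ∀ y, U2 (1/2, y) = U2 (-(1/2), y))
    (hcu : ∀ z ∈ qq, pd1 U2 z - pd2 U1 z = w (c + z.2) + Γ * (ε⁻¹ ^ 2 * P (ε⁻¹ • z))) :
    Γ = -∫ x in iq, w x := by
  have h := div_qq (f := U2) (g := fun z => 0 - U1 z) (hU2.of_le (by norm_num))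
    (contDiff_const.sub (hU1.of_le (by norm_num))) (fun y _ => f3 y) (fun x _ => by simp only [f2])
  have e : ∀ z, pd2 (fun z => 0 - U1 z) z = - pd2 U1 z := fun z => by
    rw [pd2_sub (differentiableAt_const _) (hU1.differentiable two_ne_zero z)]; simp [pd2]
  simp_rw [e, ← sub_eq_add_neg] at h
  rw [setIntegral_congr_fun qq_meas hcu, integral_add (intOn_qq (by fun_prop)) (intOn_qq (by fun_prop)),
    integral_const_mul, integral_const_mul] at h
  have h1 : ∫ z in qq, P (ε⁻¹ • z) = ε ^ 2 := by
    rw [setIntegral_eq_integral_of_forall_compl_eq_zero, Measure.integral_comp_smul, hi]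
    · simp
    · intro z hz
      by_contra h'
      have := hsup _ h'
      rw [rad_smul (by positivity), inv_mul_eq_div, div_lt_iff₀ hε] at this
      exact hz ⟨abs_le.1 (by linarith [fst_le_rad z]), abs_le.1 (by linarith [snd_le_rad z])⟩
  have h2 : ∫ z in qq, w (c + z.2) = ∫ x in iq, w x := by
    rw [int_qq' (intOn_qq (by fun_prop))]
    simp only [setIntegral_const, vol_iq, one_smul]
    rw [int_iq, int_iq, intervalIntegral.integral_comp_add_left (fun x => w x),
      show c + (1/2 : ℝ) = c + -(1/2) + 1 by ring, hwp.intervalIntegral_add_eq _ (-(1/2))]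
    norm_num
  rw [h1, h2, ← mul_pow, inv_mul_cancel₀ hε.ne'] at h
  linarith

lemma per_bd {f : ℝ → ℝ} (hf : Continuous f) (hp : Function.Periodic f 1) :
    ∃ B : ℝ, ∀ s, |f s| ≤ B := by
  obtain ⟨B, hB⟩ := (hp.isBounded_of_continuous one_ne_zero hf).exists_norm_le
  exact ⟨B, fun s => hB _ ⟨s, rfl⟩⟩

lemma per_deriv {f : ℝ → ℝ} (hp : Function.Periodic f 1) : Function.Periodic (deriv f) 1 := by
  intro x
  rw [← deriv_comp_add_const]
  congr 1
  funext s; exact hp s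

lemma w_bounds {w : ℝ → ℝ} (hw : ContDiff ℝ (⊤ : ℕ∞) w) (hp : Function.Periodic w 1) :
    ∃ M : ℝ, 0 ≤ M ∧ (∀ s, |w s| ≤ M) ∧ (∀ s, |deriv w s| ≤ M) ∧
      ∀ c s, |deriv w (c + s) - deriv w c| ≤ M * |s| := by
  have h1 : ContDiff ℝ (⊤ : ℕ∞) (deriv w) := ((contDiff_infty_iff_deriv).1 hw).2
  have h2 : ContDiff ℝ (⊤ : ℕ∞) (deriv (deriv w)) := ((contDiff_infty_iff_deriv).1 h1).2
  obtain ⟨B0, b0⟩ := per_bd hw.continuous hp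
  obtain ⟨B1, b1⟩ := per_bd h1.continuous (per_deriv hp)
  obtain ⟨B2, b2⟩ := per_bd h2.continuous (per_deriv (per_deriv hp))
  refine ⟨max B0 (max B1 B2), (abs_nonneg _).trans ((b0 0).trans (le_max_left _ _)),
    fun s => (b0 s).trans (le_max_left _ _),
    fun s => (b1 s).trans ((le_max_left _ _).trans (le_max_right _ _)), fun c s => ?_⟩
  have := convex_univ.norm_image_sub_le_of_norm_deriv_le (f := deriv w) (C := max B0 (max B1 B2))
    (fun x _ => (h1.differentiable (by simp)) x)
    (fun x _ => (b2 x).trans ((le_max_right _ _).trans (le_max_right _ _)))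
    (Set.mem_univ c) (Set.mem_univ (c + s))
  simpa using this


/-- A transport equation read in the coordinates centered at `x0`. -/
lemma tr_JL {f : ℝ × EuclideanSpace ℝ (Fin 2) → ℝ} (hf : ContDiff ℝ 2 f)
    (x0 : EuclideanSpace ℝ (Fin 2)) {v : ℝ × EuclideanSpace ℝ (Fin 2) → EuclideanSpace ℝ (Fin 2)}
    {t : ℝ}
    (h : ∀ x, deriv (fun s => f (s, x)) t + fderiv ℝ (fun y => f (t, y)) x (v (t, x)) = 0)
    (z : ℝ × ℝ) :
    dtt (fun q : ℝ × (ℝ × ℝ) => f (q.1, x0 + JL q.2)) (t, z)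
      + (v (t, x0 + JL z) 0 * pd1 (fun z => f (t, x0 + JL z)) z
        + v (t, x0 + JL z) 1 * pd2 (fun z => f (t, x0 + JL z)) z) = 0 := by
  have cR : ContDiff ℝ 2 (fun q : ℝ × (ℝ × ℝ) => f (q.1, x0 + JL q.2)) := hf.comp (by fun_prop)
  have cS : ContDiff ℝ 2 (fun y => f (t, y)) := hf.comp (by fun_prop)
  have dS := cS.differentiable two_ne_zero
  have h1 := h (x0 + JL z)
  have h2 := (dtt_has (cR.differentiable two_ne_zero) t z).deriv
  rw [← h2, pd1_JL (f := fun y => f (t, y)) dS, pd2_JL (f := fun y => f (t, y)) dS]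
  rw [vec_split (v (t, x0 + JL z)), map_add, map_smul, map_smul] at h1
  simpa using h1

/-- **Motion along the vorticity gradient for the blob-wave system.**
Let `p` be a smooth nonnegative profile supported in `B(0,1/2)` with unit mass and zero
first moment, and let `ω̄⁰(x) = w(x₂)` be a smooth shear vorticity. There is a constant
`C = C(w,p)` such that: for any `T > 0`, `ε ∈ (0,1/4]`, `Γ > 0`, any blob center `x⁰`,
and any `C²` solution `(ω̄, ρ, u)` of the blob-wave system on `[0,T] × 𝕋²` (periodic in
space; `u` divergence-free with zero mean and scalar curl `ω̄ + ρ`; `ω̄, ρ` transported by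
`u`; initial data `ω̄(0,x) = w(x₂)`, `ρ(0,x) = Γ p^ε(x − x⁰)`; `ρ(t,·)` supported in
`B(x⁰,1/4)`), if `w′(x⁰₂) > 0` then the barycenter height
`G₂(t) = Γ⁻¹ ∫ ρ(t, x⁰+y) y₂ dy` satisfies `G₂′(0) = 0` and
`|G₂″(0) − (Γ w′(x⁰₂)/(4π)) ln(1/ε)| ≤ C`; consequently, if
`(Γ w′(x⁰₂)/(4π)) ln(1/ε) > C` then `G₂` is strictly increasing on some `[0,T′] ⊆ [0,T]`. -/
theorem blob_moves_along_gradient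
    (p : EuclideanSpace ℝ (Fin 2) → ℝ) (hp : ContDiff ℝ (⊤ : ℕ∞) p)
    (hp0 : ∀ x, 0 ≤ p x) (hps : ∀ x, p x ≠ 0 → ‖x‖ < 1/2)
    (hpi : (∫ x : EuclideanSpace ℝ (Fin 2), p x) = 1)
    (hpm : (∫ x : EuclideanSpace ℝ (Fin 2), p x • x) = 0)
    (w : ℝ → ℝ) (hw : ContDiff ℝ (⊤ : ℕ∞) w) (hwper : Function.Periodic w 1) :
    ∃ C : ℝ, 0 < C ∧
      ∀ (T ε Γ : ℝ) (x0 : EuclideanSpace ℝ (Fin 2))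
        (ω ρ : ℝ × EuclideanSpace ℝ (Fin 2) → ℝ)
        (u : ℝ × EuclideanSpace ℝ (Fin 2) → EuclideanSpace ℝ (Fin 2)),
        0 < T → ε ∈ Set.Ioc (0 : ℝ) (1/4) → 0 < Γ →
        ContDiff ℝ 2 ω → ContDiff ℝ 2 ρ → ContDiff ℝ 2 u →
        -- spatial periodicity (the functions live on the torus)
        (∀ t x k, ω (t, x + zvec2 k) = ω (t, x)) →
        (∀ t x k, ρ (t, x + zvec2 k) = ρ (t, x)) →
        (∀ t x k, u (t, x + zvec2 k) = u (t, x)) →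
        -- `u` is divergence-free
        (∀ t ∈ Set.Icc (0 : ℝ) T, ∀ x,
          fderiv ℝ (fun y => u (t, y) 0) x (e2 0)
            + fderiv ℝ (fun y => u (t, y) 1) x (e2 1) = 0) →
        -- `u` has zero mean
        (∀ t ∈ Set.Icc (0 : ℝ) T, (∫ x in sq2, u (t, x)) = 0) →
        -- the scalar curl of `u` is the total vorticity `ω̄ + ρ`
        (∀ t ∈ Set.Icc (0 : ℝ) T, ∀ x,
          fderiv ℝ (fun y => u (t, y) 1) x (e2 0)
            - fderiv ℝ (fun y => u (t, y) 0) x (e2 1) = ω (t, x) + ρ (t, x)) →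
        -- transport equations `∂ₜω̄ + u·∇ω̄ = 0` and `∂ₜρ + u·∇ρ = 0`
        (∀ t ∈ Set.Icc (0 : ℝ) T, ∀ x,
          deriv (fun s => ω (s, x)) t + fderiv ℝ (fun y => ω (t, y)) x (u (t, x)) = 0) →
        (∀ t ∈ Set.Icc (0 : ℝ) T, ∀ x,
          deriv (fun s => ρ (s, x)) t + fderiv ℝ (fun y => ρ (t, y)) x (u (t, x)) = 0) →
        -- initial data
        (∀ x, ω (0, x) = w (x 1)) →
        (∀ y ∈ sq2, ρ (0, x0 + y) = Γ * (ε⁻¹ ^ 2 * p (ε⁻¹ • y))) →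
        -- the blob remains supported in `B(x⁰, 1/4)`
        (∀ t ∈ Set.Icc (0 : ℝ) T, ∀ y ∈ sq2, 1/4 ≤ ‖y‖ → ρ (t, x0 + y) = 0) →
        -- non-degenerate vorticity gradient at the blob center
        0 < deriv w (x0 1) →
        (deriv (fun t => Γ⁻¹ * ∫ y in sq2, ρ (t, x0 + y) * y 1) 0 = 0 ∧
         |deriv (deriv (fun t => Γ⁻¹ * ∫ y in sq2, ρ (t, x0 + y) * y 1)) 0
            - Γ * deriv w (x0 1) / (4 * π) * Real.log (1 / ε)| ≤ C ∧
         (C < Γ * deriv w (x0 1) / (4 * π) * Real.log (1 / ε) →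
          ∃ T' : ℝ, 0 < T' ∧ T' ≤ T ∧
            StrictMonoOn (fun t => Γ⁻¹ * ∫ y in sq2, ρ (t, x0 + y) * y 1)
              (Set.Icc 0 T'))) := by
  set P : ℝ × ℝ → ℝ := fun z => p (JL z) with hPdef
  have cP : ContDiff ℝ 2 P := (contDiff_infty.1 hp 2).comp JL.contDiff
  have P0 : ∀ z, 0 ≤ P z := fun z => hp0 _
  have Ps : ∀ z, P z ≠ 0 → rad z < 1/2 := fun z hz => by
    rw [← JL_norm]; exact hps _ hz
  have Pi1 : ∫ z, P z = 1 := by rw [← int_all]; exact hpi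
  obtain ⟨M, hM, hM0, hM1, hM2⟩ := w_bounds hw hwper
  have cw2 : ContDiff ℝ 2 w := contDiff_infty.1 hw 2
  have cdw : Continuous (deriv w) := cw2.continuous_deriv (by norm_num)
  obtain ⟨C0, hC0, hcore⟩ := core cP P0 Ps Pi1 hM hM0 cdw hM1 hM2 (-∫ x in iq, w x)
  refine ⟨C0 / |(-∫ x in iq, w x)| + 1, by positivity, ?_⟩
  intro T ε Γ x0 ω ρ u hT hε hΓ cω cρ cu pω pρ pu hdiv hmean hcurl trω trρ iω iρ hsupp hpos
  have cc : ∀ i, ContDiff ℝ 2 (fun q => u q i) := fun i => contDiff_euclidean.1 cu i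
  have cJ : ContDiff ℝ 2 (fun q : ℝ × (ℝ × ℝ) => (q.1, x0 + JL q.2)) := by fun_prop
  set R : ℝ × (ℝ × ℝ) → ℝ := fun q => ρ (q.1, x0 + JL q.2) with hR
  set O : ℝ × (ℝ × ℝ) → ℝ := fun q => ω (q.1, x0 + JL q.2) with hO
  set U1 : ℝ × (ℝ × ℝ) → ℝ := fun q => u (q.1, x0 + JL q.2) 0 with hU1
  set U2 : ℝ × (ℝ × ℝ) → ℝ := fun q => u (q.1, x0 + JL q.2) 1 with hU2
  have cR : ContDiff ℝ 2 R := cρ.comp cJ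
  have cO : ContDiff ℝ 2 O := cω.comp cJ
  have cU1 : ContDiff ℝ 2 U1 := (cc 0).comp cJ
  have cU2 : ContDiff ℝ 2 U2 := (cc 1).comp cJ
  have du : ∀ i t, Differentiable ℝ (fun y => u (t, y) i) := fun i t =>
    (((cc i).comp (by fun_prop : ContDiff ℝ 2 (fun y => (t, y)))).differentiable two_ne_zero)
  have f1 : ∀ t y, U1 (t, 1/2, y) = U1 (t, -(1/2), y) := fun t y => by
    simp only [hU1]; rw [per1h (f := fun x => u (t, x)) (pu t) x0 y]
  have f2 : ∀ t x, U1 (t, x, 1/2) = U1 (t, x, -(1/2)) := fun t x => by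
    simp only [hU1]; rw [per2h (f := fun x => u (t, x)) (pu t) x0 x]
  have f3 : ∀ t y, U2 (t, 1/2, y) = U2 (t, -(1/2), y) := fun t y => by
    simp only [hU2]; rw [per1h (f := fun x => u (t, x)) (pu t) x0 y]
  have f4 : ∀ t x, U2 (t, x, 1/2) = U2 (t, x, -(1/2)) := fun t x => by
    simp only [hU2]; rw [per2h (f := fun x => u (t, x)) (pu t) x0 x]
  have r1 : ∀ t y, R (t, 1/2, y) = R (t, -(1/2), y) := fun t y => by
    simp only [hR]; rw [per1h (f := fun x => ρ (t, x)) (pρ t) x0 y]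
  have gdiv : ∀ t ∈ Set.Icc 0 T, ∀ z,
      pd1 (fun z => U1 (t, z)) z + pd2 (fun z => U2 (t, z)) z = 0 := fun t ht z => by
    simp only [hU1, hU2]
    rw [pd1_JL (f := fun y => u (t, y) 0) (du 0 t), pd2_JL (f := fun y => u (t, y) 1) (du 1 t)]
    exact hdiv t ht _
  have gcurl : ∀ t ∈ Set.Icc 0 T, ∀ z,
      pd1 (fun z => U2 (t, z)) z - pd2 (fun z => U1 (t, z)) z = O (t, z) + R (t, z) :=
    fun t ht z => by
    simp only [hU1, hU2]
    rw [pd1_JL (f := fun y => u (t, y) 1) (du 1 t), pd2_JL (f := fun y => u (t, y) 0) (du 0 t)]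
    exact hcurl t ht _
  have gO0 : ∀ z, O (0, z) = w (x0 1 + z.2) := fun z => by
    simp only [hO]; rw [iω]; simp [JL_1]
  have gl : ∀ t ∈ Set.Icc 0 T, ∀ y, ∫ x in iq, U2 (t, x, y) = 0 := fun t ht y =>
    line_u (v := fun x => u (t, x)) (cu.comp (by fun_prop)) (pu t) (hdiv t ht) (hmean t ht) x0 y
  have gs1 : ∀ t ∈ Set.Icc 0 T, ∀ x ∈ iq, ∀ y : ℝ, |y| = 1/2 → R (t, x, y) = 0 := by
    intro t ht x hx y hy
    refine hsupp t ht (JL (x, y)) ((JL_sq2 _).2 ⟨hx, abs_le.1 hy.le⟩) ?_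
    rw [JL_norm]
    have := snd_le_rad (x, y)
    simp only at this
    linarith
  obtain ⟨G', hG, hG0, hG1⟩ := dyn (c := x0 1) hT cw2 cR cO cU1 cU2 r1 f1 f2 f3 f4 gdiv gcurl
    (fun t ht z => tr_JL cρ x0 (trρ t ht) z) (fun t ht z => tr_JL cω x0 (trω t ht) z) gO0 gl
    (fun t ht x hx => ⟨gs1 t ht x hx _ (by norm_num [abs_of_pos]),
      gs1 t ht x hx _ (by rw [abs_neg]; norm_num [abs_of_pos])⟩)
  have h0T : (0 : ℝ) ∈ Set.Icc 0 T := ⟨le_refl 0, hT.le⟩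
  have gcurl0 : ∀ z ∈ qq, pd1 (fun z => U2 (0, z)) z - pd2 (fun z => U1 (0, z)) z
      = w (x0 1 + z.2) + Γ * (ε⁻¹ ^ 2 * P (ε⁻¹ • z)) := fun z hz => by
    rw [gcurl 0 h0T z, gO0 z]
    simp only [hR]
    rw [iρ _ ((JL_sq2 z).2 hz), ← map_smul JL]
  have cU10 := slice_cd cU1 0
  have cU20 := slice_cd cU2 0
  have hΓe : Γ = -∫ x in iq, w x :=
    gam cP.continuous Ps Pi1 hw.continuous hwper hε.1 hε.2 cU10 cU20 (f2 0) (f3 0) gcurl0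
  rw [← hΓe] at hcore
  have hX := hcore ε (x0 1) _ _ hε.1 hε.2 cU10 cU20 (f1 0) (f2 0) (f3 0) (f4 0)
    (fun z _ => gdiv 0 h0T z) gcurl0 (gl 0 h0T (1/2))
  set X := ∫ z in qq, U2 (0, z) ^ 2 * deriv w (x0 1 + z.2) with hXdef
  rw [← hΓe, abs_of_pos hΓ]
  have hfun : (fun t => Γ⁻¹ * ∫ y in sq2, ρ (t, x0 + y) * y 1)
      = fun t => Γ⁻¹ * ∫ z in qq, R (t, z) * z.2 := by
    funext t
    rw [int_sq2]
    simp only [JL_1, hR]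
  rw [hfun]
  have hH : ∀ t, HasDerivAt (fun t => Γ⁻¹ * ∫ z in qq, R (t, z) * z.2) (Γ⁻¹ * G' t) t :=
    fun t => (hG t).const_mul _
  have hH1 : HasDerivAt (fun t => Γ⁻¹ * G' t) (Γ⁻¹ * X) 0 := hG1.const_mul _
  have hd : deriv (fun t => Γ⁻¹ * ∫ z in qq, R (t, z) * z.2) = fun t => Γ⁻¹ * G' t :=
    funext fun t => (hH t).deriv
  rw [hd, hH1.deriv]
  have hb : |Γ⁻¹ * X - Γ * deriv w (x0 1) / (4 * π) * Real.log (1 / ε)| ≤ C0 / Γ := by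
    have e : Γ⁻¹ * X - Γ * deriv w (x0 1) / (4 * π) * Real.log (1 / ε)
        = (X - Γ ^ 2 * (deriv w (x0 1) / (4 * π) * Real.log (1 / ε))) / Γ := by
      field_simp
    rw [e, abs_div, abs_of_pos hΓ]
    gcongr
  refine ⟨by simp [hG0], by linarith, fun hlt => ?_⟩
  refine mono_of hH (by simp [hG0]) hH1 ?_ hT
  have := (abs_le.1 hb).1
  linarith
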